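/- arXiv:1102.5763 — 2 statements merged into one kernel-verified Lean document; each statement's English description precedes it below -/
import Mathlib

section
/- Let K be a basic closed semi-algebraic set defined by g_1,…,g_m and let P(g) = {Σ_{J ⊆ {1,…,m}} σ_J Π_{k∈J} g_k : σ_J ∈ Σ[x]} be the associated preordering. Then the closure of P(g) in the weighted ℓ1-norm ‖f‖_w = Σ_α (2⌈|α|/2⌉)! |f_α| equals Psd(K). -/
open MvPolynomial

/-- The weight `w_α = (2⌈|α|/2⌉)!`. -/
def wt {n : ℕ} (α : Fin n →₀ ℕ) : ℕ :=
  (2 * (((α.sum fun _ e => e) + 1) / 2)).factorial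

/-- The weighted ℓ₁-norm `‖f‖_w = ∑_α w_α |f_α|`. -/
def wnorm {n : ℕ} (f : MvPolynomial (Fin n) ℝ) : ℝ :=
  ∑ α ∈ f.support, (wt α : ℝ) * |f.coeff α|

/-- A polynomial is a sum of squares. -/
def IsSOS {n : ℕ} (σ : MvPolynomial (Fin n) ℝ) : Prop :=
  ∃ (k : ℕ) (p : Fin k → MvPolynomial (Fin n) ℝ), σ = ∑ i, (p i) ^ 2

/-- Membership in the preordering `P(g) = {∑_J σ_J ∏_{k∈J} g_k : σ_J ∈ Σ[x]}`. -/
def memPO {n m : ℕ} (g : Fin m → MvPolynomial (Fin n) ℝ)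
    (f : MvPolynomial (Fin n) ℝ) : Prop :=
  ∃ σ : Finset (Fin m) → MvPolynomial (Fin n) ℝ,
    (∀ J, IsSOS (σ J)) ∧ f = ∑ J : Finset (Fin m), σ J * ∏ k ∈ J, g k


/-- The preordering obtained from `P` by adjoining `a`. -/
def Subsemiring.adjoinElem {B : Type*} [CommRing B] (P : Subsemiring B) (hsq : ∀ b, b * b ∈ P)
    (a : B) : Subsemiring B where
  carrier := {b | ∃ s ∈ P, ∃ t ∈ P, b = s + a * t}
  mul_mem' := by
    rintro _ _ ⟨s, hs, t, ht, rfl⟩ ⟨s', hs', t', ht', rfl⟩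
    exact ⟨s * s' + a * a * (t * t'),
      P.add_mem (P.mul_mem hs hs') (P.mul_mem (hsq a) (P.mul_mem ht ht')), s * t' + t * s',
      P.add_mem (P.mul_mem hs ht') (P.mul_mem ht hs'), by ring⟩
  one_mem' := ⟨1, P.one_mem, 0, P.zero_mem, by ring⟩
  add_mem' := by
    rintro _ _ ⟨s, hs, t, ht, rfl⟩ ⟨s', hs', t', ht', rfl⟩
    exact ⟨s + s', P.add_mem hs hs', t + t', P.add_mem ht ht', by ring⟩
  zero_mem' := ⟨0, P.zero_mem, 0, P.zero_mem, by ring⟩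

/-- Every proper preordering is contained in a total one. -/
theorem Subsemiring.exists_total_le {B : Type*} [CommRing B] (P : Subsemiring B)
    (hsq : ∀ b, b * b ∈ P) (hP : -1 ∉ P) :
    ∃ Q : Subsemiring B, P ≤ Q ∧ -1 ∉ Q ∧ ∀ b, b ∈ Q ∨ -b ∈ Q := by
  obtain ⟨Q, hPQ, hQ⟩ := zorn_le_nonempty₀ {Q : Subsemiring B | P ≤ Q ∧ -1 ∉ Q}
    (fun c hc hchain y hy => by
      refine ⟨sSup c, ⟨(hc hy).1.trans (le_sSup hy), fun h => ?_⟩, fun z hz => le_sSup hz⟩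
      rw [Subsemiring.mem_sSup_of_directedOn ⟨y, hy⟩ hchain.directedOn] at h
      obtain ⟨s, hs, h⟩ := h
      exact (hc hs).2 h) P ⟨le_rfl, hP⟩
  have hsqQ : ∀ b, b * b ∈ Q := fun b => hPQ (hsq b)
  have key : ∀ a, a ∉ Q → ∃ s ∈ Q, ∃ t ∈ Q, -1 = s + a * t := by
    intro a ha
    by_contra hcon
    have hle : Q ≤ Q.adjoinElem hsqQ a := fun b hb => ⟨b, hb, 0, Q.zero_mem, by ring⟩
    exact ha (hQ.2 (y := Q.adjoinElem hsqQ a) ⟨hPQ.trans hle, hcon⟩ hle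
      ⟨0, Q.zero_mem, 1, Q.one_mem, by ring⟩)
  refine ⟨Q, hPQ, hQ.1.2, fun b => ?_⟩
  by_contra! hb
  obtain ⟨s, hs, t, ht, h⟩ := key b hb.1
  obtain ⟨s', hs', t', ht', h'⟩ := key (-b) hb.2
  refine hQ.1.2 ?_
  have : (-1 : B) = s + s' + s * s' + b * b * (t * t') := by
    linear_combination (1 + s') * h - (b * t) * h'
  rw [this]
  exact Q.add_mem (Q.add_mem (Q.add_mem hs hs') (Q.mul_mem hs hs'))
    (Q.mul_mem (hsqQ b) (Q.mul_mem ht ht'))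

section Archimedean

variable {B : Type*} [CommRing B] [Algebra ℝ B]

theorem Subsemiring.algebraMap_mem_of_nonneg (P : Subsemiring B) (hsq : ∀ b, b * b ∈ P)
    {r : ℝ} (hr : 0 ≤ r) : algebraMap ℝ B r ∈ P := by
  rw [← Real.mul_self_sqrt hr, map_mul]
  exact hsq _

/-- A total Archimedean preordering is the nonnegativity set of a real character. -/
theorem Subsemiring.exists_character_of_total (Q : Subsemiring B) (hQ : -1 ∉ Q)
    (htot : ∀ b, b ∈ Q ∨ -b ∈ Q) (harch : ∀ b, ∃ r : ℝ, algebraMap ℝ B r - b ∈ Q) :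
    ∃ χ : B →ₐ[ℝ] ℝ, ∀ q ∈ Q, 0 ≤ χ q := by
  have hsq : ∀ b, b * b ∈ Q := fun b => (htot b).elim (fun h => Q.mul_mem h h)
    fun h => by simpa using Q.mul_mem h h
  have hpos := fun r (hr : (0 : ℝ) ≤ r) => Q.algebraMap_mem_of_nonneg hsq hr
  have hneg : ∀ r : ℝ, algebraMap ℝ B r ∈ Q → 0 ≤ r := by
    intro r hr
    by_contra! h
    refine hQ ?_
    have := Q.mul_mem hr (hpos (-r)⁻¹ (by rw [inv_nonneg]; linarith))
    rwa [← map_mul, inv_neg, mul_neg, mul_inv_cancel₀ h.ne, map_neg, map_one] at this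
  let S : B → Set ℝ := fun b => {r | algebraMap ℝ B r - b ∈ Q}
  have hbdd : ∀ b, BddBelow (S b) := by
    intro b
    obtain ⟨r, hr⟩ := harch (-b)
    refine ⟨-r, fun s hs => ?_⟩
    have := hneg (s + r) (by rw [map_add]; convert Q.add_mem hs hr using 1; ring)
    linarith
  let χ : B → ℝ := fun b => sInf (S b)
  have hle : ∀ b (r : ℝ), algebraMap ℝ B r - b ∈ Q → χ b ≤ r := fun b r h => csInf_le (hbdd b) h
  have hmem : ∀ b (r : ℝ), χ b < r → algebraMap ℝ B r - b ∈ Q := by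
    intro b r h
    obtain ⟨s, hs, hsr⟩ := exists_lt_of_csInf_lt (harch b) h
    convert Q.add_mem hs (hpos (r - s) (by linarith)) using 1
    rw [map_sub]; ring
  have hge : ∀ b (r : ℝ), b - algebraMap ℝ B r ∈ Q → r ≤ χ b := by
    intro b r h
    refine le_csInf (harch b) fun s hs => ?_
    have := hneg (s - r) (by rw [map_sub]; convert Q.add_mem hs h using 1; ring)
    linarith
  have hmem' : ∀ b (r : ℝ), r < χ b → b - algebraMap ℝ B r ∈ Q := by
    intro b r h
    rcases htot (b - algebraMap ℝ B r) with h' | h'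
    · exact h'
    · rw [neg_sub] at h'
      exact absurd (hle b r h') (not_le.2 h)
  have hconst : ∀ r : ℝ, χ (algebraMap ℝ B r) = r := fun r =>
    le_antisymm (hle _ _ (by simp)) (hge _ _ (by simp))
  have hadd : ∀ a b, χ (a + b) = χ a + χ b := by
    intro a b
    refine le_antisymm (le_of_forall_pos_le_add fun ε hε => ?_)
      (le_of_forall_pos_le_add fun ε hε => ?_)
    · refine hle _ _ ?_
      convert Q.add_mem (hmem a (χ a + ε / 2) (by linarith)) (hmem b (χ b + ε / 2) (by linarith))
        using 1
      rw [show χ a + χ b + ε = (χ a + ε / 2) + (χ b + ε / 2) by ring, map_add]; ring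
    · have := hge (a + b) ((χ a - ε / 2) + (χ b - ε / 2)) (by
        convert Q.add_mem (hmem' a (χ a - ε / 2) (by linarith))
          (hmem' b (χ b - ε / 2) (by linarith)) using 1
        rw [map_add]; ring)
      linarith
  have hsq0 : ∀ a, χ a = 0 → χ (a * a) = 0 := by
    intro a ha
    refine le_antisymm (le_of_forall_pos_le_add fun ε hε => ?_) (hge _ _ (by simpa using hsq a))
    have h1 := hmem a (√ε) (by rw [ha]; exact Real.sqrt_pos.2 hε)
    have h2 := hmem' a (-√ε) (by rw [ha]; simpa using hε)
    refine hle _ _ ?_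
    convert Q.mul_mem h1 h2 using 1
    rw [zero_add, ← Real.mul_self_sqrt hε.le, map_mul, map_neg, Real.mul_self_sqrt hε.le]; ring
  have hneg' : ∀ a, χ (-a) = -χ a := by
    intro a
    have := hadd a (-a)
    rw [add_neg_cancel, ← map_zero (algebraMap ℝ B), hconst] at this
    linarith
  have hscale : ∀ (c : ℝ) a, χ a = 0 → χ (algebraMap ℝ B c * a) = 0 := by
    have hsc : ∀ (c : ℝ) a, 0 ≤ c → χ a = 0 → χ (algebraMap ℝ B c * a) ≤ 0 := by
      intro c a hc ha
      refine le_of_forall_pos_le_add fun ε hε => hle _ _ ?_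
      have h1 := hmem a (ε / (c + 1)) (by rw [ha]; positivity)
      have h2 : 0 ≤ ε - c * (ε / (c + 1)) := by
        have : c * (ε / (c + 1)) = ε * (c / (c + 1)) := by ring
        rw [this]
        have : c / (c + 1) ≤ 1 := by rw [div_le_one (by positivity)]; linarith
        nlinarith
      convert Q.add_mem (Q.mul_mem (hpos c hc) h1) (hpos _ h2) using 1
      simp only [map_sub, map_mul, zero_add]; ring
    have hsc' : ∀ (c : ℝ) a, 0 ≤ c → χ a = 0 → χ (algebraMap ℝ B c * a) = 0 := by
      intro c a hc ha
      refine le_antisymm (hsc c a hc ha) ?_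
      have := hsc c (-a) hc (by rw [hneg', ha, neg_zero])
      rw [mul_neg, hneg'] at this
      linarith
    intro c a ha
    rcases le_total 0 c with hc | hc
    · exact hsc' c a hc ha
    · have := hsc' (-c) a (by linarith) ha
      rw [map_neg, neg_mul, hneg'] at this
      linarith
  have hsquare : ∀ a, χ (a * a) = χ a * χ a := by
    intro a
    have h0 : χ (a - algebraMap ℝ B (χ a)) = 0 := by
      rw [sub_eq_add_neg, hadd, hneg', hconst]; ring
    have e : a * a = ((a - algebraMap ℝ B (χ a)) * (a - algebraMap ℝ B (χ a)) +
        algebraMap ℝ B (2 * χ a) * (a - algebraMap ℝ B (χ a))) +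
        algebraMap ℝ B (χ a * χ a) := by
      rw [map_mul, map_mul, map_ofNat]; ring
    rw [e, hadd, hadd, hsq0 _ h0, hscale _ _ h0, hconst]; ring
  have hmul : ∀ a b, χ (a * b) = χ a * χ b := by
    intro a b
    have h1 := hsquare (a + b)
    have e : (a + b) * (a + b) = a * a + b * b + (a * b + a * b) := by ring
    rw [e, hadd, hadd, hadd, hadd a b, hsquare, hsquare] at h1
    linarith
  refine ⟨{ toFun := χ
            map_one' := by simpa using hconst 1
            map_mul' := hmul
            map_zero' := by simpa using hconst 0
            map_add' := hadd
            commutes' := hconst }, fun q hq => hge q 0 (by simpa using hq)⟩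

/-- The Archimedean Positivstellensatz (Krivine, Kadison–Dubois). -/
theorem Subsemiring.mem_of_forall_character_pos (P : Subsemiring B) (hsq : ∀ b, b * b ∈ P)
    (harch : ∀ b, ∃ r : ℝ, algebraMap ℝ B r - b ∈ P) (F : B)
    (hF : ∀ χ : B →ₐ[ℝ] ℝ, (∀ p ∈ P, 0 ≤ χ p) → 0 < χ F) : F ∈ P := by
  have hpos := fun r (hr : (0 : ℝ) ≤ r) => P.algebraMap_mem_of_nonneg hsq hr
  obtain ⟨p, hp, s, hs, h⟩ : ∃ p ∈ P, ∃ s ∈ P, F * s = 1 + p := by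
    by_contra! hcon
    have hle : P ≤ P.adjoinElem hsq (-F) := fun b hb => ⟨b, hb, 0, P.zero_mem, by ring⟩
    obtain ⟨Q, hPQ, hQ, htot⟩ := (P.adjoinElem hsq (-F)).exists_total_le (fun b => hle (hsq b))
      (by
        rintro ⟨p, hp, s, hs, h⟩
        exact hcon p hp s hs (by linear_combination h))
    obtain ⟨χ, hχ⟩ := Q.exists_character_of_total hQ htot
      fun b => (harch b).imp fun r hr => hPQ (hle hr)
    have h1 := hF χ fun p hp => hχ p (hPQ (hle hp))
    have h2 := hχ (-F) (hPQ ⟨0, P.zero_mem, 1, P.one_mem, by ring⟩)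
    rw [map_neg] at h2
    linarith
  obtain ⟨k₁, hk₁⟩ := harch s
  obtain ⟨k₂, hk₂⟩ := harch (F * s * s)
  obtain ⟨k, hk, hks, hkF⟩ : ∃ k : ℝ, 0 < k ∧ algebraMap ℝ B k - s ∈ P ∧
      algebraMap ℝ B k - F * s * s ∈ P := by
    refine ⟨1 + |k₁| + |k₂|, by positivity, ?_, ?_⟩
    · convert P.add_mem hk₁ (hpos (1 + |k₁| + |k₂| - k₁)
        (by linarith [le_abs_self k₁, abs_nonneg k₂])) using 1
      rw [map_sub]; ring
    · convert P.add_mem hk₂ (hpos (1 + |k₁| + |k₂| - k₂)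
        (by linarith [le_abs_self k₂, abs_nonneg k₁])) using 1
      rw [map_sub]; ring
  have hstep : ∀ r : ℝ, 0 ≤ r → F + algebraMap ℝ B r ∈ P → F + algebraMap ℝ B (r - 1 / k) ∈ P := by
    intro r hr hFr
    set κ := algebraMap ℝ B k with hκ
    have h1 : (κ - s) * (κ - s) * (F + algebraMap ℝ B r) + algebraMap ℝ B (2 * k) * p +
        algebraMap ℝ B r * s * (κ + (κ - s)) + (κ - F * s * s) ∈ P :=
      P.add_mem (P.add_mem (P.add_mem (P.mul_mem (hsq _) hFr)
        (P.mul_mem (hpos _ (by positivity)) hp))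
        (P.mul_mem (P.mul_mem (hpos _ hr) hs) (P.add_mem (hpos _ hk.le) hks))) hkF
    have h2 : (κ - s) * (κ - s) * (F + algebraMap ℝ B r) + algebraMap ℝ B (2 * k) * p +
        algebraMap ℝ B r * s * (κ + (κ - s)) + (κ - F * s * s) =
        κ * κ * (F + algebraMap ℝ B r) - κ := by
      rw [map_mul, map_ofNat, ← hκ]
      linear_combination (-2 * κ) * h
    rw [h2] at h1
    convert P.mul_mem (hpos ((1 / k) * (1 / k)) (by positivity)) h1 using 1
    have h3 : algebraMap ℝ B (1 / k) * κ = 1 := by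
      rw [hκ, ← map_mul, one_div, inv_mul_cancel₀ hk.ne', map_one]
    rw [map_sub, map_mul]
    linear_combination (-(algebraMap ℝ B (1 / k) * κ + 1) * (F + algebraMap ℝ B r) +
      algebraMap ℝ B (1 / k)) * h3
  let R : Set ℝ := {r | 0 ≤ r ∧ F + algebraMap ℝ B r ∈ P}
  have hRb : BddBelow R := ⟨0, fun r hr => hr.1⟩
  have hRn : R.Nonempty := by
    obtain ⟨r, hr⟩ := harch (-F)
    refine ⟨|r|, abs_nonneg r, ?_⟩
    convert P.add_mem hr (hpos (|r| - r) (by linarith [le_abs_self r])) using 1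
    rw [map_sub]; ring
  obtain ⟨r, ⟨hr, hFr⟩, hlt⟩ := exists_lt_of_csInf_lt hRn
    (show sInf R < sInf R + 1 / k by simpa using hk)
  have hr' : r - 1 / k < 0 := by
    by_contra! hcon
    linarith [csInf_le hRb (show r - 1 / k ∈ R from ⟨hcon, hstep r hr hFr⟩)]
  convert P.add_mem (hstep r hr hFr) (hpos (-(r - 1 / k)) (by linarith)) using 1
  rw [map_neg]; ring

end Archimedean

section Preordering

variable {n m : ℕ}

theorem isSOS_iff_isSumSq {s : MvPolynomial (Fin n) ℝ} : IsSOS s ↔ IsSumSq s := by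
  refine ⟨?_, fun h => ?_⟩
  · rintro ⟨k, p, rfl⟩
    exact IsSumSq.sum_sq _ _
  · induction h with
    | zero => exact ⟨0, Fin.elim0, by simp⟩
    | sq_add a _ ih =>
      obtain ⟨k, p, rfl⟩ := ih
      exact ⟨k + 1, Fin.cons a p, by simp [Fin.sum_univ_succ, sq]⟩

theorem memPO_sos_mul_prod (g : Fin m → MvPolynomial (Fin n) ℝ) {s : MvPolynomial (Fin n) ℝ}
    (hs : IsSumSq s) (J : Finset (Fin m)) : memPO g (s * ∏ k ∈ J, g k) := by
  refine ⟨Pi.single J s, fun I => ?_, ?_⟩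
  · rw [isSOS_iff_isSumSq]
    by_cases h : I = J
    · subst h; simpa using hs
    · simp [h]
  · rw [Finset.sum_eq_single J]
    · simp
    · intro I _ h; simp [h]
    · simp

theorem memPO_add {g : Fin m → MvPolynomial (Fin n) ℝ} {a b : MvPolynomial (Fin n) ℝ}
    (ha : memPO g a) (hb : memPO g b) : memPO g (a + b) := by
  obtain ⟨σ, hσ, rfl⟩ := ha
  obtain ⟨τ, hτ, rfl⟩ := hb
  refine ⟨σ + τ, fun J => ?_, by simp [add_mul, Finset.sum_add_distrib]⟩
  have h1 := hσ J
  have h2 := hτ J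
  rw [isSOS_iff_isSumSq] at *
  exact h1.add h2

theorem memPO_zero (g : Fin m → MvPolynomial (Fin n) ℝ) : memPO g 0 := by
  simpa using memPO_sos_mul_prod g IsSumSq.zero ∅

theorem memPO_sum {ι : Type*} {g : Fin m → MvPolynomial (Fin n) ℝ} (I : Finset ι)
    (a : ι → MvPolynomial (Fin n) ℝ) (h : ∀ i ∈ I, memPO g (a i)) : memPO g (∑ i ∈ I, a i) :=
  Finset.sum_induction _ _ (fun _ _ => memPO_add) (memPO_zero g) h

theorem memPO_mul {g : Fin m → MvPolynomial (Fin n) ℝ} {a b : MvPolynomial (Fin n) ℝ}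
    (ha : memPO g a) (hb : memPO g b) : memPO g (a * b) := by
  obtain ⟨σ, hσ, rfl⟩ := ha
  obtain ⟨τ, hτ, rfl⟩ := hb
  rw [Finset.sum_mul_sum]
  refine memPO_sum _ _ fun I _ => memPO_sum _ _ fun J _ => ?_
  have h1 : (∏ k ∈ I, g k) * ∏ k ∈ J, g k =
      (∏ k ∈ I ∩ J, g k) * (∏ k ∈ I ∩ J, g k) * ∏ k ∈ (I ∪ J) \ (I ∩ J), g k := by
    rw [← Finset.prod_union_inter, ← Finset.prod_sdiff
      (Finset.inter_subset_left.trans Finset.subset_union_left : I ∩ J ⊆ I ∪ J)]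
    ring
  have h2 : (σ I * ∏ k ∈ I, g k) * (τ J * ∏ k ∈ J, g k) =
      (σ I * τ J * ((∏ k ∈ I ∩ J, g k) * (∏ k ∈ I ∩ J, g k))) *
        ∏ k ∈ (I ∪ J) \ (I ∩ J), g k := by
    linear_combination (σ I * τ J) * h1
  rw [h2]
  exact memPO_sos_mul_prod g (((isSOS_iff_isSumSq.1 (hσ I)).mul (isSOS_iff_isSumSq.1 (hτ J))).mul
    (IsSumSq.mul_self _)) _

/-- The preordering `P(g)` as a subsemiring. -/
def preordering (g : Fin m → MvPolynomial (Fin n) ℝ) : Subsemiring (MvPolynomial (Fin n) ℝ) where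
  carrier := {f | memPO g f}
  mul_mem' := memPO_mul
  one_mem' := by simpa using memPO_sos_mul_prod g IsSumSq.one ∅
  add_mem' := memPO_add
  zero_mem' := memPO_zero g

theorem isSumSq_mem_preordering (g : Fin m → MvPolynomial (Fin n) ℝ)
    {s : MvPolynomial (Fin n) ℝ} (hs : IsSumSq s) : s ∈ preordering g := by
  show memPO g s
  simpa using memPO_sos_mul_prod g hs ∅

theorem mul_self_mem_preordering (g : Fin m → MvPolynomial (Fin n) ℝ)
    (s : MvPolynomial (Fin n) ℝ) : s * s ∈ preordering g :=
  isSumSq_mem_preordering g (IsSumSq.mul_self s)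

theorem C_mem_preordering (g : Fin m → MvPolynomial (Fin n) ℝ) {r : ℝ} (hr : 0 ≤ r) :
    C r ∈ preordering g :=
  (preordering g).algebraMap_mem_of_nonneg (mul_self_mem_preordering g) hr

theorem generator_mem_preordering (g : Fin m → MvPolynomial (Fin n) ℝ) (j : Fin m) :
    g j ∈ preordering g := by
  show memPO g (g j)
  simpa using memPO_sos_mul_prod g IsSumSq.one {j}

theorem eval_nonneg_of_mem_preordering {g : Fin m → MvPolynomial (Fin n) ℝ} {x : Fin n → ℝ}
    (hx : ∀ j, 0 ≤ eval x (g j)) {f : MvPolynomial (Fin n) ℝ} (hf : f ∈ preordering g) :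
    0 ≤ eval x f := by
  obtain ⟨σ, hσ, rfl⟩ := hf
  rw [map_sum]
  refine Finset.sum_nonneg fun J _ => ?_
  obtain ⟨k, p, hp⟩ := hσ J
  rw [hp, map_mul, map_sum, map_prod]
  refine mul_nonneg (Finset.sum_nonneg fun i _ => ?_) (Finset.prod_nonneg fun j _ => hx j)
  rw [map_pow]
  positivity

end Preordering

section WeightedNorm

variable {n : ℕ}

theorem wnorm_eq_sum_of_subset (f : MvPolynomial (Fin n) ℝ) {s : Finset (Fin n →₀ ℕ)}
    (hs : f.support ⊆ s) : wnorm f = ∑ α ∈ s, (wt α : ℝ) * |f.coeff α| := by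
  refine Finset.sum_subset hs fun α _ h => ?_
  rw [notMem_support_iff.1 h, abs_zero, mul_zero]

theorem wnorm_nonneg (f : MvPolynomial (Fin n) ℝ) : 0 ≤ wnorm f :=
  Finset.sum_nonneg fun _ _ => by positivity

theorem wnorm_add_le (f g : MvPolynomial (Fin n) ℝ) : wnorm (f + g) ≤ wnorm f + wnorm g := by
  classical
  rw [wnorm_eq_sum_of_subset (f + g) support_add,
    wnorm_eq_sum_of_subset f Finset.subset_union_left,
    wnorm_eq_sum_of_subset g Finset.subset_union_right, ← Finset.sum_add_distrib]
  refine Finset.sum_le_sum fun α _ => ?_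
  rw [coeff_add, ← mul_add]
  gcongr
  exact abs_add_le _ _

theorem wnorm_smul (c : ℝ) (f : MvPolynomial (Fin n) ℝ) : wnorm (c • f) = |c| * wnorm f := by
  rw [wnorm_eq_sum_of_subset (c • f) support_smul, wnorm, Finset.mul_sum]
  refine Finset.sum_congr rfl fun α _ => ?_
  rw [coeff_smul, smul_eq_mul, abs_mul]; ring

theorem wnorm_neg (f : MvPolynomial (Fin n) ℝ) : wnorm (-f) = wnorm f := by
  simpa using wnorm_smul (-1) f

theorem wnorm_monomial (α : Fin n →₀ ℕ) (c : ℝ) : wnorm (monomial α c) = wt α * |c| := by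
  rw [wnorm_eq_sum_of_subset _ support_monomial_subset]
  simp

theorem wnorm_zero : wnorm (0 : MvPolynomial (Fin n) ℝ) = 0 := by
  simp [wnorm]

theorem factorial_degree_le_wt (α : Fin n →₀ ℕ) : (α.sum fun _ e => e).factorial ≤ wt α :=
  Nat.factorial_le (by lia)

theorem wt_le_factorial (α : Fin n →₀ ℕ) : wt α ≤ ((α.sum fun _ e => e) + 1).factorial :=
  Nat.factorial_le (by lia)

theorem exists_abs_eval_le_mul_wnorm (x : Fin n → ℝ) :
    ∃ D : ℝ, 0 < D ∧ ∀ f : MvPolynomial (Fin n) ℝ, |eval x f| ≤ D * wnorm f := by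
  set r := ∑ i, |x i| with hr
  have hxr : ∀ i, |x i| ≤ r := fun i =>
    Finset.single_le_sum (f := fun i => |x i|) (fun _ _ => abs_nonneg _) (Finset.mem_univ i)
  have hr0 : 0 ≤ r := Finset.sum_nonneg fun _ _ => abs_nonneg _
  refine ⟨Real.exp r, Real.exp_pos _, fun f => ?_⟩
  rw [eval_eq, wnorm, Finset.mul_sum]
  refine (Finset.abs_sum_le_sum_abs _ _).trans (Finset.sum_le_sum fun α _ => ?_)
  rw [abs_mul, mul_comm, ← mul_assoc]
  gcongr
  have h1 : |∏ i ∈ α.support, x i ^ α i| ≤ r ^ (α.sum fun _ e => e) := by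
    rw [Finset.abs_prod, Finsupp.sum, ← Finset.prod_pow_eq_pow_sum]
    refine Finset.prod_le_prod (fun _ _ => abs_nonneg _) fun i _ => ?_
    rw [abs_pow]
    exact pow_le_pow_left₀ (abs_nonneg _) (hxr i) _
  have h2 := Real.pow_div_factorial_le_exp r hr0 (α.sum fun _ e => e)
  rw [div_le_iff₀ (by positivity)] at h2
  refine h1.trans (h2.trans ?_)
  gcongr
  exact factorial_degree_le_wt α

/-- Hahn–Banach separation of a point from a convex cone that is at positive distance from it. -/
theorem exists_separating_functional (P : Subsemiring (MvPolynomial (Fin n) ℝ))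
    (hP : ∀ c : ℝ, 0 ≤ c → C c ∈ P) (f : MvPolynomial (Fin n) ℝ) {ε : ℝ} (hε : 0 < ε)
    (hf : ∀ h ∈ P, ε ≤ wnorm (f - h)) :
    ∃ L : MvPolynomial (Fin n) ℝ →ₗ[ℝ] ℝ,
      (∀ p ∈ P, 0 ≤ L p) ∧ (∀ p, |L p| ≤ wnorm p) ∧ L f < 0 := by
  let S : MvPolynomial (Fin n) ℝ → Set ℝ := fun p => {r | ∃ h ∈ P, r = wnorm (p + h)}
  let N : MvPolynomial (Fin n) ℝ → ℝ := fun p => sInf (S p)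
  have hbdd : ∀ p, BddBelow (S p) := fun p => ⟨0, by rintro _ ⟨h, -, rfl⟩; exact wnorm_nonneg _⟩
  have hne : ∀ p, (S p).Nonempty := fun p => ⟨_, 0, P.zero_mem, rfl⟩
  have hle : ∀ p, ∀ h ∈ P, N p ≤ wnorm (p + h) := fun p h hh => csInf_le (hbdd p) ⟨h, hh, rfl⟩
  have hNadd : ∀ p q, N (p + q) ≤ N p + N q := by
    intro p q
    refine le_of_forall_pos_le_add fun δ hδ => ?_
    obtain ⟨_, ⟨h₁, hh₁, rfl⟩, h1⟩ := exists_lt_of_csInf_lt (hne p)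
      (show sInf (S p) < N p + δ / 2 by simpa [N] using hδ)
    obtain ⟨_, ⟨h₂, hh₂, rfl⟩, h2⟩ := exists_lt_of_csInf_lt (hne q)
      (show sInf (S q) < N q + δ / 2 by simpa [N] using hδ)
    have h3 := hle (p + q) (h₁ + h₂) (P.add_mem hh₁ hh₂)
    have h4 := wnorm_add_le (p + h₁) (q + h₂)
    rw [show p + q + (h₁ + h₂) = p + h₁ + (q + h₂) by ring] at h3
    linarith
  have hNsmul_le : ∀ c : ℝ, 0 < c → ∀ p, N (c • p) ≤ c * N p := by
    intro c hc p
    rw [← div_le_iff₀' hc]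
    refine le_csInf (hne p) ?_
    rintro _ ⟨h, hh, rfl⟩
    rw [div_le_iff₀' hc]
    have := hle (c • p) (c • h) (by rw [smul_eq_C_mul]; exact P.mul_mem (hP c hc.le) hh)
    rwa [← smul_add, wnorm_smul, abs_of_pos hc] at this
  have hNsmul : ∀ c : ℝ, 0 < c → ∀ p, N (c • p) = c * N p := by
    intro c hc p
    refine le_antisymm (hNsmul_le c hc p) ?_
    have := hNsmul_le c⁻¹ (inv_pos.2 hc) (c • p)
    rwa [smul_smul, inv_mul_cancel₀ hc.ne', one_smul, inv_mul_eq_div, le_div_iff₀' hc] at this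
  have hN0 : N 0 = 0 := by
    have := hNsmul 2 two_pos 0
    rw [smul_zero] at this
    linarith
  have hNf : ε ≤ N (-f) := by
    refine le_csInf (hne _) ?_
    rintro _ ⟨h, hh, rfl⟩
    rw [← wnorm_neg, neg_add, neg_neg, ← sub_eq_add_neg]
    exact hf h hh
  have hf0 : -f ≠ 0 := by
    intro h
    rw [h, hN0] at hNf
    linarith
  obtain ⟨L, hL, hLN⟩ := exists_extension_of_le_sublinear
    (LinearPMap.mkSpanSingleton (-f) (N (-f)) hf0) N hNsmul hNadd (by
      rintro ⟨x, hx⟩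
      obtain ⟨c, rfl⟩ := Submodule.mem_span_singleton.1 hx
      have hval : (LinearPMap.mkSpanSingleton (-f) (N (-f)) hf0 :
          MvPolynomial (Fin n) ℝ →ₗ.[ℝ] ℝ) ⟨c • -f, hx⟩ = c * N (-f) :=
        LinearPMap.mkSpanSingleton'_apply _ _ _ c hx
      rw [hval]
      rcases lt_trichotomy c 0 with hc | rfl | hc
      · have h1 := hNadd (c • -f) (-c • -f)
        rw [← add_smul, add_neg_cancel, zero_smul, hN0, hNsmul (-c) (by linarith)] at h1
        linarith
      · simp [hN0]
      · exact (hNsmul c hc _).ge)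
  have hLw : ∀ p, L p ≤ wnorm p := fun p => (hLN p).trans (by simpa using hle p 0 P.zero_mem)
  refine ⟨L, fun p hp => ?_, fun p => abs_le.2 ⟨?_, hLw p⟩, ?_⟩
  · have := (hLN (-p)).trans (hle (-p) p hp)
    rw [neg_add_cancel, wnorm_zero, map_neg] at this
    linarith
  · have := hLw (-p)
    rw [map_neg, wnorm_neg] at this
    linarith
  · have := hL ⟨-f, Submodule.mem_span_singleton_self _⟩
    have h2 : L (-f) = N (-f) := by
      rw [this]
      exact LinearPMap.mkSpanSingleton_apply ℝ ℝ hf0 (N (-f))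
    rw [map_neg] at h2
    linarith

end WeightedNorm

section BoundedFractions

variable {n m : ℕ}

/-- The polynomial `∏ j, (1 + x_j ^ 2)`. -/
noncomputable def theta (n : ℕ) : MvPolynomial (Fin n) ℝ := ∏ j, (1 + X j * X j)

theorem isSumSq_C {r : ℝ} (hr : 0 ≤ r) : IsSumSq (C r : MvPolynomial (Fin n) ℝ) := by
  rw [← Real.mul_self_sqrt hr, C_mul]
  exact IsSumSq.mul_self _

theorem isSumSq_theta : IsSumSq (theta n) :=
  IsSumSq.prod fun j _ => IsSumSq.one.add (IsSumSq.mul_self (X j))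

theorem theta_mem_preordering (g : Fin m → MvPolynomial (Fin n) ℝ) : theta n ∈ preordering g :=
  isSumSq_mem_preordering g isSumSq_theta

theorem eval_theta_pos (x : Fin n → ℝ) : 0 < eval x (theta n) := by
  rw [theta, map_prod]
  refine Finset.prod_pos fun j _ => ?_
  simp only [map_add, map_one, map_mul, eval_X]
  nlinarith [mul_self_nonneg (x j)]

theorem isSumSq_prod_sub_one (s : Finset (Fin n)) :
    IsSumSq ((∏ j ∈ s, (1 + X j * X j)) - 1 : MvPolynomial (Fin n) ℝ) := by
  induction s using Finset.cons_induction with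
  | empty => simp
  | cons i s hi ih =>
    rw [Finset.prod_cons]
    have e : (1 + X i * X i) * (∏ j ∈ s, (1 + X j * X j)) - 1 =
        ((∏ j ∈ s, (1 + X j * X j)) - 1 : MvPolynomial (Fin n) ℝ) +
          X i * X i * ∏ j ∈ s, (1 + X j * X j) := by
      ring
    rw [e]
    exact ih.add ((IsSumSq.mul_self _).mul
      (IsSumSq.prod fun j _ => IsSumSq.one.add (IsSumSq.mul_self (X j))))

theorem isSumSq_theta_sub (i : Fin n) : IsSumSq (theta n - (1 + X i * X i)) := by
  have e : theta n - (1 + X i * X i) =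
      (1 + X i * X i) * ((∏ j ∈ Finset.univ.erase i, (1 + X j * X j)) - 1) := by
    rw [theta, ← Finset.mul_prod_erase _ _ (Finset.mem_univ i)]; ring
  rw [e]
  exact (IsSumSq.one.add (IsSumSq.mul_self _)).mul (isSumSq_prod_sub_one _)

/-- `p` is bounded, up to sums of squares, by a multiple of `theta n ^ N`. -/
def IsThetaBounded (p : MvPolynomial (Fin n) ℝ) (N : ℕ) : Prop :=
  ∃ c : ℝ, 0 ≤ c ∧ IsSumSq (C c * theta n ^ N - p) ∧ IsSumSq (C c * theta n ^ N + p)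

namespace IsThetaBounded

variable {p q : MvPolynomial (Fin n) ℝ} {N M : ℕ}

theorem const (r : ℝ) : IsThetaBounded (C r : MvPolynomial (Fin n) ℝ) 0 := by
  refine ⟨|r|, abs_nonneg r, ?_, ?_⟩
  · rw [pow_zero, mul_one, ← C_sub]
    exact isSumSq_C (by linarith [le_abs_self r])
  · rw [pow_zero, mul_one, ← C_add]
    exact isSumSq_C (by linarith [neg_abs_le r])

theorem add (hp : IsThetaBounded p N) (hq : IsThetaBounded q N) : IsThetaBounded (p + q) N := by
  obtain ⟨c, hc, h1, h2⟩ := hp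
  obtain ⟨d, hd, h3, h4⟩ := hq
  refine ⟨c + d, add_nonneg hc hd, ?_, ?_⟩
  · have e : C (c + d) * theta n ^ N - (p + q) =
        (C c * theta n ^ N - p) + (C d * theta n ^ N - q) := by
      rw [C_add]; ring
    rw [e]
    exact h1.add h3
  · have e : C (c + d) * theta n ^ N + (p + q) =
        (C c * theta n ^ N + p) + (C d * theta n ^ N + q) := by
      rw [C_add]; ring
    rw [e]
    exact h2.add h4

theorem mul (hp : IsThetaBounded p N) (hq : IsThetaBounded q M) :
    IsThetaBounded (p * q) (N + M) := by
  obtain ⟨c, hc, h1, h2⟩ := hp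
  obtain ⟨d, hd, h3, h4⟩ := hq
  have half : IsSumSq (C (1 / 2) : MvPolynomial (Fin n) ℝ) := isSumSq_C (by norm_num)
  have two : (C (1 / 2) * 2 : MvPolynomial (Fin n) ℝ) = 1 := by
    rw [← map_ofNat C 2, ← C_mul]; norm_num
  refine ⟨c * d, mul_nonneg hc hd, ?_, ?_⟩
  · have e : C (c * d) * theta n ^ (N + M) - p * q =
        C (1 / 2) * ((C c * theta n ^ N - p) * (C d * theta n ^ M + q) +
          (C c * theta n ^ N + p) * (C d * theta n ^ M - q)) := by
      rw [C_mul, pow_add]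
      linear_combination (-(C c * theta n ^ N * (C d * theta n ^ M)) + p * q) * two
    rw [e]
    exact half.mul ((h1.mul h4).add (h2.mul h3))
  · have e : C (c * d) * theta n ^ (N + M) + p * q =
        C (1 / 2) * ((C c * theta n ^ N - p) * (C d * theta n ^ M - q) +
          (C c * theta n ^ N + p) * (C d * theta n ^ M + q)) := by
      rw [C_mul, pow_add]
      linear_combination (-(C c * theta n ^ N * (C d * theta n ^ M)) - p * q) * two
    rw [e]
    exact half.mul ((h1.mul h3).add (h2.mul h4))

theorem one : IsThetaBounded (1 : MvPolynomial (Fin n) ℝ) 1 := by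
  refine ⟨1, zero_le_one, ?_, ?_⟩
  · simpa [theta] using isSumSq_prod_sub_one (n := n) Finset.univ
  · simpa using isSumSq_theta.add IsSumSq.one

theorem mono (hp : IsThetaBounded p N) (h : N ≤ M) : IsThetaBounded p M := by
  induction M, h using Nat.le_induction with
  | base => exact hp
  | succ M _ ih => simpa using ih.mul one

theorem var (i : Fin n) : IsThetaBounded (X i : MvPolynomial (Fin n) ℝ) 1 := by
  have q : (C (1 / 2) * 2 : MvPolynomial (Fin n) ℝ) = 1 := by
    rw [← map_ofNat C 2, ← C_mul]; norm_num
  have h : ∀ s : MvPolynomial (Fin n) ℝ, s * s = 1 → IsSumSq (C 1 * theta n ^ 1 + s * X i) := by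
    intro s hs
    have e : C 1 * theta n ^ 1 + s * X i = (theta n - (1 + X i * X i)) + C (1 / 2) *
        ((1 + s * X i) * (1 + s * X i) + (1 * 1 + X i * X i)) := by
      rw [C_1]
      linear_combination (-(1 + X i * X i + s * X i)) * q - (C (1 / 2) * X i * X i) * hs
    rw [e]
    exact (isSumSq_theta_sub i).add ((isSumSq_C (by norm_num)).mul
      ((IsSumSq.mul_self _).add ((IsSumSq.mul_self _).add (IsSumSq.mul_self _))))
  refine ⟨1, zero_le_one, ?_, ?_⟩
  · simpa [sub_eq_add_neg] using h (-1) (by ring)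
  · simpa using h 1 (by ring)

end IsThetaBounded

theorem exists_isThetaBounded (p : MvPolynomial (Fin n) ℝ) : ∃ N, IsThetaBounded p N := by
  induction p using MvPolynomial.induction_on with
  | C r => exact ⟨0, .const r⟩
  | add p q hp hq =>
    obtain ⟨N, hN⟩ := hp
    obtain ⟨M, hM⟩ := hq
    exact ⟨N + M, (hN.mono (by lia)).add (hM.mono (by lia))⟩
  | mul_X p i hp =>
    obtain ⟨N, hN⟩ := hp
    exact ⟨N + 1, hN.mul (.var i)⟩

/-- The algebra of functions `p / theta n ^ N` with `p` bounded by a multiple of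
`theta n ^ N`. -/
noncomputable def boundedFractions (n : ℕ) : Subalgebra ℝ ((Fin n → ℝ) → ℝ) where
  carrier := {b | ∃ N p, IsThetaBounded p N ∧ ∀ x, b x * eval x (theta n) ^ N = eval x p}
  mul_mem' := by
    rintro a b ⟨N, p, hp, ha⟩ ⟨M, q, hq, hb⟩
    refine ⟨N + M, p * q, hp.mul hq, fun x => ?_⟩
    rw [map_mul, ← ha, ← hb, Pi.mul_apply]; ring
  add_mem' := by
    rintro a b ⟨N, p, hp, ha⟩ ⟨M, q, hq, hb⟩
    have h1 : IsThetaBounded (theta n ^ M) M :=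
      ⟨1, zero_le_one, by simp, by
        simpa using (IsSumSq.prod (I := Finset.range M) fun _ _ => isSumSq_theta (n := n)).add
          (IsSumSq.prod (I := Finset.range M) fun _ _ => isSumSq_theta (n := n))⟩
    have h2 : IsThetaBounded (theta n ^ N) N :=
      ⟨1, zero_le_one, by simp, by
        simpa using (IsSumSq.prod (I := Finset.range N) fun _ _ => isSumSq_theta (n := n)).add
          (IsSumSq.prod (I := Finset.range N) fun _ _ => isSumSq_theta (n := n))⟩
    refine ⟨N + M, p * theta n ^ M + theta n ^ N * q, (hp.mul h1).add (h2.mul hq), fun x => ?_⟩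
    rw [map_add, map_mul, map_mul, ← ha, ← hb, Pi.add_apply, map_pow, map_pow]; ring
  algebraMap_mem' r := ⟨0, C r, .const r, fun x => by simp⟩

/-- The function `p / theta n ^ N` as an element of `boundedFractions n`. -/
noncomputable def boundedFraction (p : MvPolynomial (Fin n) ℝ) (N : ℕ) (h : IsThetaBounded p N) :
    boundedFractions n :=
  ⟨fun x => eval x p / eval x (theta n) ^ N, N, p, h, fun x =>
    div_mul_cancel₀ _ (pow_pos (eval_theta_pos x) N).ne'⟩

/-- The preordering induced by `P(g)` on `boundedFractions n`. -/
noncomputable def fractionPreordering (g : Fin m → MvPolynomial (Fin n) ℝ) :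
    Subsemiring (boundedFractions n) where
  carrier := {b | ∃ N, ∃ p ∈ preordering g, ∀ x, b.1 x * eval x (theta n) ^ N = eval x p}
  mul_mem' := by
    rintro a b ⟨N, p, hp, ha⟩ ⟨M, q, hq, hb⟩
    refine ⟨N + M, p * q, mul_mem hp hq, fun x => ?_⟩
    rw [map_mul, ← ha, ← hb, Subalgebra.coe_mul, Pi.mul_apply]; ring
  one_mem' := ⟨0, 1, one_mem _, fun x => by simp⟩
  add_mem' := by
    rintro a b ⟨N, p, hp, ha⟩ ⟨M, q, hq, hb⟩
    have ht := theta_mem_preordering g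
    refine ⟨N + M, p * theta n ^ M + theta n ^ N * q,
      add_mem (mul_mem hp (pow_mem ht M)) (mul_mem (pow_mem ht N) hq), fun x => ?_⟩
    rw [map_add, map_mul, map_mul, ← ha, ← hb, Subalgebra.coe_add, Pi.add_apply, map_pow,
      map_pow]
    ring
  zero_mem' := ⟨0, 0, zero_mem _, fun x => by simp⟩

theorem boundedFraction_mem {g : Fin m → MvPolynomial (Fin n) ℝ} {p : MvPolynomial (Fin n) ℝ}
    (hp : p ∈ preordering g) {N : ℕ} (h : IsThetaBounded p N) :
    boundedFraction p N h ∈ fractionPreordering g :=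
  ⟨N, p, hp, fun x => div_mul_cancel₀ _ (pow_pos (eval_theta_pos x) N).ne'⟩

theorem mul_self_mem_fractionPreordering (g : Fin m → MvPolynomial (Fin n) ℝ)
    (b : boundedFractions n) : b * b ∈ fractionPreordering g := by
  obtain ⟨N, p, -, h⟩ := b.2
  refine ⟨N + N, p * p, mul_self_mem_preordering g p, fun x => ?_⟩
  rw [map_mul, ← h, Subalgebra.coe_mul, Pi.mul_apply]; ring

theorem exists_algebraMap_sub_mem_fractionPreordering (g : Fin m → MvPolynomial (Fin n) ℝ)
    (b : boundedFractions n) :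
    ∃ r : ℝ, algebraMap ℝ (boundedFractions n) r - b ∈ fractionPreordering g := by
  obtain ⟨N, p, ⟨c, -, hc, -⟩, h⟩ := b.2
  refine ⟨c, N, _, isSumSq_mem_preordering g hc, fun x => ?_⟩
  have : (algebraMap ℝ (boundedFractions n) c - b).1 x = c - b.1 x := rfl
  rw [this, map_sub, ← h, map_mul, eval_C, map_pow]; ring

section Characters

variable (χ : boundedFractions n →ₐ[ℝ] ℝ)

theorem map_boundedFraction_add {p : MvPolynomial (Fin n) ℝ} {N : ℕ} (hp : IsThetaBounded p N)
    (M : ℕ) (h : IsThetaBounded p (N + M)) :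
    χ (boundedFraction p (N + M) h) =
      χ (boundedFraction p N hp) * χ (boundedFraction 1 1 .one) ^ M := by
  have e : boundedFraction p (N + M) h =
      boundedFraction p N hp * boundedFraction 1 1 .one ^ M :=
    Subtype.ext (funext fun x => by
      have := eval_theta_pos x
      simp only [boundedFraction, Subalgebra.coe_mul, Subalgebra.coe_pow, Pi.mul_apply,
        Pi.pow_apply, map_one, pow_one, div_pow, one_pow, pow_add]
      field_simp)
  rw [e, map_mul, map_pow]

/-- A character not vanishing at `1 / theta n` is the evaluation at a point. -/
theorem exists_point_of_character (hχ : χ (boundedFraction 1 1 .one) ≠ 0) :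
    ∃ a : Fin n → ℝ, ∀ p N (h : IsThetaBounded p N),
      χ (boundedFraction p N h) = eval a p * χ (boundedFraction 1 1 .one) ^ N := by
  set c := χ (boundedFraction 1 1 .one) with hc
  let a : Fin n → ℝ := fun i => χ (boundedFraction (X i) 1 (.var i)) / c
  have key : ∀ p, ∃ N, ∃ h : IsThetaBounded p N,
      χ (boundedFraction p N h) = eval a p * c ^ N := by
    intro p
    induction p using MvPolynomial.induction_on with
    | C r =>
      refine ⟨0, .const r, ?_⟩
      have : boundedFraction (C r) 0 (.const r) = algebraMap ℝ (boundedFractions n) r :=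
        Subtype.ext (funext fun x => by simp [boundedFraction])
      rw [this, AlgHom.commutes, eval_C]; simp
    | add p q hp hq =>
      obtain ⟨N, hN, h1⟩ := hp
      obtain ⟨M, hM, h2⟩ := hq
      have hN' : IsThetaBounded p (N + M) := hN.mono (by lia)
      have hM' : IsThetaBounded q (M + N) := hM.mono (by lia)
      have hM'' : IsThetaBounded q (N + M) := hM.mono (by lia)
      refine ⟨N + M, hN'.add hM'', ?_⟩
      have : boundedFraction (p + q) (N + M) (hN'.add hM'') =
          boundedFraction p (N + M) hN' + boundedFraction q (M + N) hM' :=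
        Subtype.ext (funext fun x => by
          simp only [boundedFraction, Subalgebra.coe_add, Pi.add_apply, map_add]
          rw [add_comm M N, add_div])
      rw [this, map_add, map_boundedFraction_add χ hN, map_boundedFraction_add χ hM, h1, h2,
        map_add, ← hc]
      ring
    | mul_X p i hp =>
      obtain ⟨N, hN, h1⟩ := hp
      refine ⟨N + 1, hN.mul (.var i), ?_⟩
      have : boundedFraction (p * X i) (N + 1) (hN.mul (.var i)) =
          boundedFraction p N hN * boundedFraction (X i) 1 (.var i) :=
        Subtype.ext (funext fun x => by
          have := eval_theta_pos x
          simp only [boundedFraction, Subalgebra.coe_mul, Pi.mul_apply, map_mul, pow_succ]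
          field_simp)
      rw [this, map_mul, h1, map_mul, eval_X, pow_succ]
      linear_combination (-(eval a p * c ^ N)) *
        div_mul_cancel₀ (χ (boundedFraction (X i) 1 (.var i))) hχ
  refine ⟨a, fun p N h => ?_⟩
  obtain ⟨M, hM, h1⟩ := key p
  have h2 := map_boundedFraction_add χ h M (h.mono (by lia))
  have h3 := map_boundedFraction_add χ hM N (hM.mono (by lia))
  have h4 : boundedFraction p (N + M) (h.mono (by lia)) =
      boundedFraction p (M + N) (hM.mono (by lia)) :=
    Subtype.ext (funext fun x => by simp only [boundedFraction, add_comm])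
  rw [h4, h3, h1, ← hc] at h2
  have h5 : c ^ M ≠ 0 := pow_ne_zero _ hχ
  apply mul_right_cancel₀ h5
  rw [← h2]; ring

end Characters

/-- A denominator-clearing Positivstellensatz for polynomials nonnegative on a possibly
non-compact basic closed semialgebraic set. -/
theorem exists_theta_pow_mul_mem_preordering (g : Fin m → MvPolynomial (Fin n) ℝ)
    (f : MvPolynomial (Fin n) ℝ) (hf : ∀ x, (∀ j, 0 ≤ eval x (g j)) → 0 ≤ eval x f) :
    ∃ k, ∀ ε : ℝ, 0 < ε → ∃ N, theta n ^ N * (f + C ε * theta n ^ k) ∈ preordering g := by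
  obtain ⟨k, hk⟩ := exists_isThetaBounded f
  have hk' : IsThetaBounded f (k + 1) := hk.mono (by lia)
  refine ⟨k + 1, fun ε hε => ?_⟩
  obtain ⟨N, p, hp, h⟩ := (fractionPreordering g).mem_of_forall_character_pos
    (mul_self_mem_fractionPreordering g) (exists_algebraMap_sub_mem_fractionPreordering g)
    (boundedFraction f (k + 1) hk' + algebraMap ℝ _ ε) (by
      intro χ hχ
      rw [map_add, AlgHom.commutes]
      refine add_pos_of_nonneg_of_pos ?_ hε
      by_cases h0 : χ (boundedFraction 1 1 .one) = 0
      · rw [map_boundedFraction_add χ hk, h0]; simp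
      · obtain ⟨a, ha⟩ := exists_point_of_character χ h0
        have hc : 0 < χ (boundedFraction 1 1 .one) :=
          lt_of_le_of_ne (hχ _ (boundedFraction_mem (one_mem _) _)) (Ne.symm h0)
        rw [ha]
        refine mul_nonneg (hf a fun j => ?_) (by positivity)
        obtain ⟨M, hM⟩ := exists_isThetaBounded (g j)
        have h1 := hχ _ (boundedFraction_mem (generator_mem_preordering g j) hM)
        rw [ha] at h1
        exact nonneg_of_mul_nonneg_left h1 (by positivity))
  refine ⟨N, ?_⟩
  have e : theta n ^ N * (f + C ε * theta n ^ (k + 1)) = theta n ^ (k + 1) * p := by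
    refine MvPolynomial.funext fun x => ?_
    have h1 := h x
    have h2 : (boundedFraction f (k + 1) hk' + algebraMap ℝ (boundedFractions n) ε).1 x =
      eval x f / eval x (theta n) ^ (k + 1) + ε := rfl
    have := eval_theta_pos x
    rw [h2] at h1
    rw [map_mul, map_mul, ← h1, map_add, map_mul, map_pow, map_pow, eval_C]
    field_simp
  rw [e]
  exact mul_mem (pow_mem (theta_mem_preordering g) _) hp

end BoundedFractions

section FactorialGrowth

open scoped Nat

theorem Nat.factorial_succ_le_pow (k : ℕ) : (k + 1)! ≤ (k + 1) ^ k := by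
  have h := Nat.factorial_mul_descFactorial (Nat.le_succ k)
  have h1 := Nat.descFactorial_le_pow (k + 1) k
  simp only [Nat.succ_eq_add_one, Nat.add_sub_cancel_left, Nat.factorial_one, one_mul] at h
  rwa [h] at h1

theorem Nat.factorial_add_le (m b : ℕ) : (m + b)! ≤ 2 ^ (m + b) * (m ! * b !) := by
  rw [← Nat.add_choose_mul_factorial_mul_factorial, mul_assoc]
  exact Nat.mul_le_mul_right _ (Nat.choose_le_two_pow _ _)

theorem choose_mul_pow_mul_factorial_le {N k b : ℕ} (hk : k + 1 ≤ N) :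
    (N.choose (k + 1) : ℝ) * ((1 / (8 * N)) ^ 2) ^ (k + 1) * (2 * (k + 1) + b)! ≤
      2 ^ b * b ! * (1 / 4) ^ (k + 1) / N := by
  have hN : (0 : ℝ) < N := by exact_mod_cast (by lia : 0 < N)
  have h1 : (N.choose (k + 1) : ℝ) ≤ N ^ (k + 1) / (k + 1)! := Nat.choose_le_pow_div _ _
  have h2 : ((2 * (k + 1) + b)! : ℝ) ≤
      2 ^ (2 * (k + 1) + b) * (2 ^ (2 * (k + 1)) * ((k + 1)! * (k + 1)!) * b !) := by
    have h3 := Nat.factorial_add_le (2 * (k + 1)) b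
    have h4 := Nat.factorial_add_le (k + 1) (k + 1)
    rw [← two_mul] at h4
    exact_mod_cast h3.trans (Nat.mul_le_mul_left _ (Nat.mul_le_mul_right _ h4))
  have h3 : ((k + 1)! : ℝ) ≤ N ^ k := by
    exact_mod_cast (Nat.factorial_succ_le_pow k).trans (Nat.pow_le_pow_left hk k)
  have hf : (0 : ℝ) < (k + 1)! := by exact_mod_cast Nat.factorial_pos _
  calc _ ≤ (N ^ (k + 1) / (k + 1)! : ℝ) * ((1 / (8 * N)) ^ 2) ^ (k + 1) *
        (2 ^ (2 * (k + 1) + b) * (2 ^ (2 * (k + 1)) * ((k + 1)! * (k + 1)!) * b !)) := by gcongr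
    _ = 2 ^ b * b ! * (1 / 4) ^ (k + 1) * (k + 1)! / N ^ (k + 1) := by
        have e : (64 : ℝ) ^ (k + 1) = 2 ^ (2 * (k + 1)) * 2 ^ (2 * (k + 1)) * 4 ^ (k + 1) := by
          rw [pow_mul, ← mul_pow, ← mul_pow]; norm_num
        have e1 : (((1 : ℝ) / (8 * N)) ^ 2) ^ (k + 1) =
            1 / (64 ^ (k + 1) * (N ^ (k + 1) * N ^ (k + 1))) := by
          rw [div_pow, mul_pow, div_pow, mul_pow, ← mul_pow (N : ℝ)]; norm_num [sq]
        rw [e1, e, pow_add 2 (2 * (k + 1)) b, div_pow, one_pow]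
        field_simp
    _ ≤ 2 ^ b * b ! * (1 / 4) ^ (k + 1) * N ^ k / N ^ (k + 1) := by gcongr
    _ = _ := by rw [pow_succ (N : ℝ)]; field_simp

theorem sum_quarter_pow_le (N : ℕ) : ∑ k ∈ Finset.range N, (1 / 4 : ℝ) ^ (k + 1) ≤ 1 := by
  have h : ∑ k ∈ Finset.range N, (1 / 4 : ℝ) ^ (k + 1) ≤ 1 - (1 / 4) ^ N := by
    induction N with
    | zero => simp
    | succ N ih =>
      rw [Finset.sum_range_succ, pow_succ]
      have : (0 : ℝ) < (1 / 4) ^ N := by positivity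
      linarith
  have : (0 : ℝ) < (1 / 4) ^ N := by positivity
  linarith

variable {n : ℕ} (L : MvPolynomial (Fin n) ℝ →ₗ[ℝ] ℝ)

theorem exists_abs_map_mul_pow_le (hL : ∀ p, |L p| ≤ wnorm p) (j : Fin n)
    (p : MvPolynomial (Fin n) ℝ) :
    ∃ D : ℝ, ∃ b : ℕ, 0 ≤ D ∧ ∀ k, |L (p * (X j ^ 2) ^ k)| ≤ D * (2 * k + b)! := by
  induction p using MvPolynomial.induction_on' with
  | monomial α c =>
    refine ⟨|c|, (α.sum fun _ e => e) + 1, abs_nonneg c, fun k => ?_⟩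
    have e : monomial α c * (X j ^ 2) ^ k = monomial (α + Finsupp.single j (2 * k)) c := by
      rw [← pow_mul, X_pow_eq_monomial, monomial_mul, mul_one]
    rw [e]
    refine (hL _).trans ?_
    rw [wnorm_monomial, mul_comm]
    refine mul_le_mul_of_nonneg_left ?_ (abs_nonneg c)
    have h := wt_le_factorial (α + Finsupp.single j (2 * k))
    rw [Finsupp.sum_add_index' (fun _ => rfl) (fun _ _ _ => rfl), Finsupp.sum_single_index rfl] at h
    rw [show 2 * k + ((α.sum fun _ e => e) + 1) = (α.sum fun _ e => e) + 2 * k + 1 by ring]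
    exact_mod_cast h
  | add p q hp hq =>
    obtain ⟨D, b, hD, h1⟩ := hp
    obtain ⟨D', b', hD', h2⟩ := hq
    refine ⟨D + D', b + b', add_nonneg hD hD', fun k => ?_⟩
    rw [add_mul, map_add, add_mul]
    refine (abs_add_le _ _).trans (add_le_add ((h1 k).trans ?_) ((h2 k).trans ?_))
    · gcongr; lia
    · gcongr; lia

theorem exists_abs_map_mul_pow_sub_one_le (hL : ∀ p, |L p| ≤ wnorm p) (j : Fin n)
    (p : MvPolynomial (Fin n) ℝ) :
    ∃ D : ℝ, ∀ N : ℕ, |L (p * ((1 + C ((1 / (8 * N : ℝ)) ^ 2) * X j ^ 2) ^ N - 1))| ≤ D / N := by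
  obtain ⟨D, b, hD, h⟩ := exists_abs_map_mul_pow_le L hL j p
  refine ⟨D * (2 ^ b * b !), fun N => ?_⟩
  have e : p * ((1 + C ((1 / (8 * N : ℝ)) ^ 2) * X j ^ 2) ^ N - 1) =
      ∑ k ∈ Finset.range N, ((N.choose (k + 1) : ℝ) * ((1 / (8 * N)) ^ 2) ^ (k + 1)) •
        (p * (X j ^ 2) ^ (k + 1)) := by
    rw [add_comm, add_pow, Finset.sum_range_succ']
    simp only [one_pow, mul_one, pow_zero, Nat.choose_zero_right, Nat.cast_one,
      add_sub_cancel_right, Finset.mul_sum]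
    refine Finset.sum_congr rfl fun k _ => ?_
    rw [smul_eq_C_mul, C_mul, mul_pow, ← map_natCast (C : ℝ →+* MvPolynomial (Fin n) ℝ), ← C_pow]
    ring
  rw [e, map_sum]
  calc _ ≤ ∑ k ∈ Finset.range N, D * (2 ^ b * b ! / N) * (1 / 4 : ℝ) ^ (k + 1) := by
        refine (Finset.abs_sum_le_sum_abs _ _).trans (Finset.sum_le_sum fun k hk => ?_)
        have h1 := choose_mul_pow_mul_factorial_le (b := b) (Finset.mem_range.1 hk)
        rw [map_smul, smul_eq_mul, abs_mul, abs_of_nonneg (by positivity)]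
        calc _ ≤ (N.choose (k + 1) : ℝ) * ((1 / (8 * N)) ^ 2) ^ (k + 1) *
              (D * (2 * (k + 1) + b)!) := by gcongr; exact h (k + 1)
          _ = D * ((N.choose (k + 1) : ℝ) * ((1 / (8 * N)) ^ 2) ^ (k + 1) *
              (2 * (k + 1) + b)!) := by ring
          _ ≤ D * (2 ^ b * b ! * (1 / 4) ^ (k + 1) / N) := by gcongr
          _ = _ := by ring
    _ ≤ D * (2 ^ b * b ! / N) * 1 := by
        rw [← Finset.mul_sum]
        exact mul_le_mul_of_nonneg_left (sum_quarter_pow_le N) (by positivity)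
    _ = _ := by ring

end FactorialGrowth

section Density

variable {n : ℕ}

/-- Polynomials `A ≡ α` modulo `1 + x_j ^ 2` with `α ≥ 1` that are small in the sense of
`A ^ 2 ≤ (1 + a ^ 2 x_j ^ 2) ^ k`. -/
theorem exists_mul_self_add_mul_self_eq (a : ℝ) (ha : 0 ≤ a) (j : Fin n) (k : ℕ) :
    ∃ A B M : MvPolynomial (Fin n) ℝ, ∃ α : ℝ,
      A * A + X j * B * (X j * B) = (1 + C (a ^ 2) * X j ^ 2) ^ k ∧
      A = C α + (1 + X j * X j) * M ∧ 1 + a ^ 2 * (k * (k - 1) / 2) ≤ α := by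
  suffices h : ∃ A B M M' : MvPolynomial (Fin n) ℝ, ∃ α β : ℝ,
      A * A + X j * B * (X j * B) = (1 + C (a ^ 2) * X j ^ 2) ^ k ∧
      A = C α + (1 + X j * X j) * M ∧ B = C β + (1 + X j * X j) * M' ∧
      1 + a ^ 2 * (k * (k - 1) / 2) ≤ α ∧ k * a ≤ β by
    obtain ⟨A, B, M, M', α, β, h1, h2, -, h3, -⟩ := h
    exact ⟨A, B, M, α, h1, h2, h3⟩
  induction k with
  | zero => exact ⟨1, 0, 0, 0, 1, 0, by simp, by simp, by simp, by simp, by simp⟩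
  | succ k ih =>
    obtain ⟨A, B, M, M', α, β, h1, h2, h3, h4, h5⟩ := ih
    refine ⟨A - C a * (X j * X j) * B, B + C a * A, M - C a * B + C a * M', M' + C a * M,
      α + a * β, β + a * α, ?_, ?_, ?_, ?_, ?_⟩
    · rw [pow_succ, ← h1, C_pow]; ring
    · rw [C_add, C_mul]
      linear_combination h2 + C a * h3
    · rw [C_add, C_mul]
      linear_combination h3 + C a * h2
    · push_cast
      nlinarith [mul_le_mul_of_nonneg_left h5 ha]
    · have hk : (0 : ℝ) ≤ k * (k - 1) / 2 := by
        rcases k with - | k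
        · simp
        · push_cast; rw [add_sub_cancel_right]; positivity
      have : 1 ≤ α := le_trans (by nlinarith [mul_nonneg (sq_nonneg a) hk]) h4
      push_cast
      nlinarith

variable {L : MvPolynomial (Fin n) ℝ →ₗ[ℝ] ℝ} {u : MvPolynomial (Fin n) ℝ}

theorem map_mul_add_mul_self_le (hpos : ∀ p, IsSumSq p → 0 ≤ L p) (hu : IsSumSq u)
    (p q : MvPolynomial (Fin n) ℝ) :
    L (u * ((p + q) * (p + q))) ≤ 2 * L (u * (p * p)) + 2 * L (u * (q * q)) := by
  have h := hpos _ (hu.mul (IsSumSq.mul_self (p - q)))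
  have e : u * ((p + q) * (p + q)) =
      (2 : ℝ) • (u * (p * p)) + (2 : ℝ) • (u * (q * q)) - u * ((p - q) * (p - q)) := by
    simp only [smul_eq_C_mul, map_ofNat]; ring
  rw [e, map_sub, map_add, map_smul, map_smul, smul_eq_mul, smul_eq_mul]
  linarith

theorem exists_map_mul_sub_mul_self_lt (hL : ∀ p, |L p| ≤ wnorm p)
    (hpos : ∀ p, IsSumSq p → 0 ≤ L p) (hu : IsSumSq u) (j : Fin n) (h : MvPolynomial (Fin n) ℝ)
    {δ : ℝ} (hδ : 0 < δ) :
    ∃ q, L (u * ((h - (1 + X j * X j) * h * q) * (h - (1 + X j * X j) * h * q))) < δ := by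
  by_contra! hcon
  set Q : MvPolynomial (Fin n) ℝ → ℝ := fun q =>
    L (u * ((h - (1 + X j * X j) * h * q) * (h - (1 + X j * X j) * h * q))) with hQ
  have hbdd : BddBelow (Set.range Q) := ⟨δ, by rintro _ ⟨q, rfl⟩; exact hcon q⟩
  set d := sInf (Set.range Q) with hd
  have hd0 : 0 < d := hδ.trans_le (le_csInf (Set.range_nonempty Q)
    (by rintro _ ⟨q, rfl⟩; exact hcon q))
  obtain ⟨_, ⟨q, rfl⟩, hq⟩ := exists_lt_of_csInf_lt (Set.range_nonempty Q)
    (show d < d * (257 / 256) ^ 2 by nlinarith)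
  set e := h - (1 + X j * X j) * h * q with he
  obtain ⟨D, hD⟩ := exists_abs_map_mul_pow_sub_one_le L hL j (u * (e * e))
  have hlim : Filter.Tendsto (fun N : ℕ => Q q + D / N) Filter.atTop (nhds (Q q + 0)) :=
    tendsto_const_nhds.add (tendsto_const_div_atTop_nhds_zero_nat D)
  rw [add_zero] at hlim
  obtain ⟨N, hN, hN2⟩ := ((hlim.eventually_lt_const hq).and (Filter.eventually_ge_atTop 2)).exists
  have hN0 : (2 : ℝ) ≤ N := by exact_mod_cast hN2
  obtain ⟨A, B, M, α, h1, h2, h3⟩ :=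
    exists_mul_self_add_mul_self_eq (1 / (8 * N)) (by positivity) j N
  have hα : 257 / 256 ≤ α := by
    refine le_trans ?_ h3
    have : (1 / (8 * N) : ℝ) ^ 2 * (N * (N - 1) / 2) = (1 - 1 / N) / 128 := by
      field_simp; ring
    rw [this]
    have : (1 : ℝ) / N ≤ 1 / 2 := one_div_le_one_div_of_le (by norm_num) hN0
    linarith
  have hα0 : α ≠ 0 := by linarith
  have key : e * A =
      C α * (h - (1 + X j * X j) * h * (q - C α⁻¹ * (1 - (1 + X j * X j) * q) * M)) := by
    have hc : C α * C α⁻¹ = (1 : MvPolynomial (Fin n) ℝ) := by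
      rw [← C_mul, mul_inv_cancel₀ hα0, C_1]
    rw [h2, he]
    linear_combination (-((1 + X j * X j) * h * (1 - (1 + X j * X j) * q) * M)) * hc
  have h4 : L (u * (e * A * (e * A))) =
      α ^ 2 * Q (q - C α⁻¹ * (1 - (1 + X j * X j) * q) * M) := by
    have e1 : ∀ p : MvPolynomial (Fin n) ℝ, u * (C α * p * (C α * p)) = α ^ 2 • (u * (p * p)) :=
      fun p => by rw [smul_eq_C_mul, C_pow]; ring
    rw [key, e1, map_smul, smul_eq_mul]
  have h5 : L (u * (e * A * (e * A))) ≤ Q q + D / N := by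
    have h6 := hpos _ (hu.mul (IsSumSq.mul_self (e * (X j * B))))
    have h7 := (le_abs_self _).trans (hD N)
    have e1 : u * (e * A * (e * A)) = u * (e * e) +
        u * (e * e) * ((1 + C ((1 / (8 * N : ℝ)) ^ 2) * X j ^ 2) ^ N - 1) -
        u * (e * (X j * B) * (e * (X j * B))) := by
      rw [← h1]; ring
    rw [e1, map_sub, map_add]
    linarith
  have h8 : d ≤ Q (q - C α⁻¹ * (1 - (1 + X j * X j) * q) * M) := csInf_le hbdd ⟨_, rfl⟩
  have h9 : d * (257 / 256) ^ 2 ≤ α ^ 2 * Q (q - C α⁻¹ * (1 - (1 + X j * X j) * q) * M) := by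
    rw [mul_comm]; gcongr
  linarith

theorem exists_map_one_sub_mul_self_lt_mul (hL : ∀ p, |L p| ≤ wnorm p)
    (hpos : ∀ p, IsSumSq p → 0 ≤ L p) (hu : IsSumSq u) (j : Fin n) {h : MvPolynomial (Fin n) ℝ}
    (hh : ∀ δ : ℝ, 0 < δ → ∃ q, L (u * ((1 - h * q) * (1 - h * q))) < δ) (δ : ℝ) (hδ : 0 < δ) :
    ∃ q, L (u * ((1 - (1 + X j * X j) * h * q) * (1 - (1 + X j * X j) * h * q))) < δ := by
  obtain ⟨q₀, h0⟩ := hh (δ / 4) (by positivity)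
  obtain ⟨q, hq⟩ := exists_map_mul_sub_mul_self_lt hL hpos hu j (h * q₀)
    (show 0 < δ / 4 by positivity)
  refine ⟨q₀ * q, ?_⟩
  have e : 1 - (1 + X j * X j) * h * (q₀ * q) =
      (1 - h * q₀) + (h * q₀ - (1 + X j * X j) * (h * q₀) * q) := by ring
  rw [e]
  have := map_mul_add_mul_self_le hpos hu (1 - h * q₀) (h * q₀ - (1 + X j * X j) * (h * q₀) * q)
  linarith

theorem exists_map_one_sub_theta_pow_mul_self_lt (hL : ∀ p, |L p| ≤ wnorm p)
    (hpos : ∀ p, IsSumSq p → 0 ≤ L p) (hu : IsSumSq u) (N : ℕ) :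
    ∀ δ : ℝ, 0 < δ →
      ∃ q, L (u * ((1 - theta n ^ N * q) * (1 - theta n ^ N * q))) < δ := by
  induction N with
  | zero => exact fun δ hδ => ⟨1, by simpa using hδ⟩
  | succ N ih =>
    suffices ∀ s : Finset (Fin n), ∀ δ : ℝ, 0 < δ →
        ∃ q, L (u * ((1 - (∏ j ∈ s, (1 + X j * X j)) * theta n ^ N * q) *
          (1 - (∏ j ∈ s, (1 + X j * X j)) * theta n ^ N * q))) < δ by
      simpa only [pow_succ', theta] using this Finset.univ
    intro s
    induction s using Finset.cons_induction with
    | empty => simpa using ih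
    | cons j s hj ih =>
      simpa only [Finset.prod_cons, mul_assoc] using
        exists_map_one_sub_mul_self_lt_mul hL hpos hu j ih

end Density

section Closure

variable {n m : ℕ} {g : Fin m → MvPolynomial (Fin n) ℝ} {L : MvPolynomial (Fin n) ℝ →ₗ[ℝ] ℝ}

theorem map_nonneg_of_theta_pow_mul_mem (hL : ∀ p, |L p| ≤ wnorm p)
    (hpos : ∀ p ∈ preordering g, 0 ≤ L p) {F : MvPolynomial (Fin n) ℝ} {N : ℕ}
    (hF : theta n ^ N * F ∈ preordering g) : 0 ≤ L F := by
  have hsq : ∀ p, IsSumSq p → 0 ≤ L p := fun p hp => hpos p (isSumSq_mem_preordering g hp)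
  refine le_of_forall_pos_lt_add fun ε hε => ?_
  have h1 : 0 ≤ L 1 := hpos _ (one_mem _)
  set s := (L 1 + 1) * 2 / ε with hs
  have hs0 : 0 < s := by positivity
  obtain ⟨q, hq⟩ := exists_map_one_sub_theta_pow_mul_self_lt hL hsq
    (u := 1 + F * F) (IsSumSq.one.add (IsSumSq.mul_self F)) N (ε / (2 * (s + 1))) (by positivity)
  set e := 1 - theta n ^ N * q with he
  have h2 : 0 ≤ L ((1 - e) * (1 - e) * F) := by
    have h3 : (1 - e) * (1 - e) * F = q * q * (theta n ^ N * (theta n ^ N * F)) := by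
      rw [he]; ring
    rw [h3]
    exact hpos _ (mul_mem (mul_self_mem_preordering g q)
      (mul_mem (pow_mem (theta_mem_preordering g) N) hF))
  have h3 : 0 ≤ L ((1 + F * F) * (e * e)) - L (e * e * F) := by
    rw [← map_sub]
    have h4 : (1 + F * F) * (e * e) - e * e * F =
        e * (1 - C (1 / 2) * F) * (e * (1 - C (1 / 2) * F)) + C (3 / 4) * (e * F * (e * F)) := by
      have c1 : (C (1 / 2) * 2 : MvPolynomial (Fin n) ℝ) = 1 := by
        rw [← map_ofNat C 2, ← C_mul]; norm_num
      have c2 : (C (1 / 2) * C (1 / 2) + C (3 / 4) : MvPolynomial (Fin n) ℝ) = 1 := by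
        rw [← C_mul, ← C_add]; norm_num
      linear_combination (e * e * F) * c1 - (e * F * (e * F)) * c2
    rw [h4]
    exact hsq _ ((IsSumSq.mul_self _).add ((isSumSq_C (by norm_num)).mul (IsSumSq.mul_self _)))
  have h4 : 0 ≤ 2 * L (e * F) + s * L ((1 + F * F) * (e * e)) + s⁻¹ * L 1 := by
    have h5 : (2 : ℝ) • (e * F) + s • ((1 + F * F) * (e * e)) + s⁻¹ • 1 =
        C s * (e * e) + C s * ((e * F + C s⁻¹) * (e * F + C s⁻¹)) := by
      have c : C s * C s⁻¹ = (1 : MvPolynomial (Fin n) ℝ) := by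
        rw [← C_mul, mul_inv_cancel₀ hs0.ne', C_1]
      simp only [smul_eq_C_mul, map_ofNat]
      linear_combination (-(2 * e * F) - C s⁻¹) * c
    have h6 := hsq _ (((isSumSq_C hs0.le).mul (IsSumSq.mul_self e)).add
      ((isSumSq_C hs0.le).mul (IsSumSq.mul_self (e * F + C s⁻¹))))
    rw [← h5] at h6
    simpa only [map_add, map_smul, smul_eq_mul] using h6
  have h5 : L ((1 - e) * (1 - e) * F) = L F - 2 * L (e * F) + L (e * e * F) := by
    have h6 : (1 - e) * (1 - e) * F = F - (2 : ℝ) • (e * F) + e * e * F := by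
      simp only [smul_eq_C_mul, map_ofNat]; ring
    rw [h6, map_add, map_sub, map_smul, smul_eq_mul]
  have h6 : (s + 1) * L ((1 + F * F) * (e * e)) < ε / 2 := by
    calc _ < (s + 1) * (ε / (2 * (s + 1))) := by gcongr
      _ = ε / 2 := by field_simp
  have h7 : s⁻¹ * L 1 ≤ ε / 2 := by
    rw [hs, inv_div, div_mul_eq_mul_div, div_le_div_iff₀ (by positivity) (by positivity)]
    nlinarith
  linarith

theorem map_nonneg_of_nonneg_on (hL : ∀ p, |L p| ≤ wnorm p)
    (hpos : ∀ p ∈ preordering g, 0 ≤ L p) {f : MvPolynomial (Fin n) ℝ}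
    (hf : ∀ x, (∀ j, 0 ≤ eval x (g j)) → 0 ≤ eval x f) : 0 ≤ L f := by
  obtain ⟨k, hk⟩ := exists_theta_pow_mul_mem_preordering g f hf
  have h0 : 0 ≤ L (theta n ^ k) := hpos _ (pow_mem (theta_mem_preordering g) k)
  refine le_of_forall_pos_le_add fun ε hε => ?_
  obtain ⟨N, hN⟩ := hk (ε / (L (theta n ^ k) + 1)) (by positivity)
  have h1 := map_nonneg_of_theta_pow_mul_mem hL hpos hN
  rw [← smul_eq_C_mul, map_add, map_smul, smul_eq_mul] at h1
  refine h1.trans (add_le_add_right ?_ _)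
  rw [div_mul_eq_mul_div, div_le_iff₀ (by positivity)]
  nlinarith

end Closure

theorem stmt5 {n m : ℕ} (g : Fin m → MvPolynomial (Fin n) ℝ)
    (K : Set (Fin n → ℝ)) (hK : K = {x | ∀ j, 0 ≤ eval x (g j)}) :
    {f : MvPolynomial (Fin n) ℝ |
        ∀ ε : ℝ, 0 < ε → ∃ h, memPO g h ∧ wnorm (f - h) < ε} =
      {f : MvPolynomial (Fin n) ℝ | ∀ x ∈ K, 0 ≤ eval x f} := by
  subst hK
  refine Set.Subset.antisymm (fun f hf x hx => ?_) fun f hf => ?_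
  · obtain ⟨D, hD, hx'⟩ := exists_abs_eval_le_mul_wnorm x
    refine le_of_forall_pos_le_add fun ε hε => ?_
    obtain ⟨h, hh, hlt⟩ := hf (ε / D) (by positivity)
    have h1 : 0 ≤ eval x h := eval_nonneg_of_mem_preordering hx hh
    have h2 := (neg_abs_le _).trans' (neg_le_neg (hx' (f - h)))
    have h3 : D * wnorm (f - h) < ε := by rwa [mul_comm, ← lt_div_iff₀ hD]
    rw [map_sub] at h2
    linarith
  · by_contra hcon
    simp only [Set.mem_ofPred_eq, not_forall] at hcon
    obtain ⟨ε, hε, hcon⟩ := hcon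
    push Not at hcon
    obtain ⟨L, hpos, hL, hLf⟩ := exists_separating_functional (preordering g)
      (fun c hc => C_mem_preordering g hc) f hε hcon
    exact hLf.not_ge (map_nonneg_of_nonneg_on hL hpos hf)
end

section
/- Let μ⁺ and μ⁻ be finite Borel measures on ℝⁿ, each satisfying the multivariate Carleman condition (so each is determinate by its moments), and let ψ be a finite Borel measure on ℝⁿ. If ∫ x^α dμ⁺ = ∫ x^α dμ⁻ + ∫ x^α dψ for all α ∈ ℕⁿ, then μ⁺ = μ⁻ + ψ as measures. -/
open MeasureTheory

/-- A finite Borel measure satisfies the multivariate Carleman condition if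
`∑ₖ (∫ xᵢ^{2k} dν)^{-1/2k} = ∞` for every coordinate `i`. -/
def Carleman {n : ℕ} (ν : Measure (Fin n → ℝ)) : Prop :=
  ∀ i : Fin n,
    ¬ Summable (fun k : ℕ =>
      (∫ x, x i ^ (2 * (k + 1)) ∂ν) ^ (-(1 / (2 * ((k : ℝ) + 1)))))

theorem sum_weighted_le (a : ℕ → ℝ) (ha : ∀ k, 0 ≤ a k) (K : ℕ) :
    ∑ k ∈ Finset.range K, (∑ j ∈ Finset.range (k + 1), ((j : ℝ) + 1) * a j) / ((k : ℝ) + 1) ^ 2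
      ≤ 2 * ∑ k ∈ Finset.range K, a k := by
  have key : ∑ k ∈ Finset.range K,
        (∑ j ∈ Finset.range (k + 1), ((j : ℝ) + 1) * a j) / ((k : ℝ) + 1) ^ 2
      + 2 / ((K : ℝ) + 1) * ∑ j ∈ Finset.range K, ((j : ℝ) + 1) * a j
      ≤ 2 * ∑ k ∈ Finset.range K, a k := by
    induction K with
    | zero => simp
    | succ K ih =>
      rw [Finset.sum_range_succ, Finset.sum_range_succ a]
      have hT : ∑ j ∈ Finset.range (K + 1), ((j : ℝ) + 1) * a j
          = ∑ j ∈ Finset.range K, ((j : ℝ) + 1) * a j + ((K : ℝ) + 1) * a K :=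
        Finset.sum_range_succ _ _
      have hT0 : 0 ≤ ∑ j ∈ Finset.range (K + 1), ((j : ℝ) + 1) * a j :=
        Finset.sum_nonneg fun j _ => mul_nonneg (by positivity) (ha j)
      set T := ∑ j ∈ Finset.range (K + 1), ((j : ℝ) + 1) * a j
      have hc : 1 / ((K : ℝ) + 1) ^ 2 + 2 / ((K : ℝ) + 2) ≤ 2 / ((K : ℝ) + 1) := by
        rw [div_add_div _ _ (by positivity) (by positivity),
          div_le_div_iff₀ (by positivity) (by positivity)]
        have : (0 : ℝ) ≤ K := K.cast_nonneg
        nlinarith [mul_nonneg this this, mul_nonneg (mul_nonneg this this) this]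
      have h1 := mul_le_mul_of_nonneg_right hc hT0
      have h2 : 2 / ((K : ℝ) + 1) * (∑ j ∈ Finset.range K, ((j : ℝ) + 1) * a j)
          = 2 / ((K : ℝ) + 1) * T - 2 * a K := by
        rw [hT]; field_simp; ring
      rw [h2] at ih
      have h3 : T / ((K : ℝ) + 1) ^ 2 = 1 / ((K : ℝ) + 1) ^ 2 * T := by ring
      push_cast
      rw [h3, show (K : ℝ) + 1 + 1 = K + 2 by ring]
      linarith
  refine le_trans (le_add_of_nonneg_right ?_) key
  exact mul_nonneg (by positivity)
    (Finset.sum_nonneg fun j _ => mul_nonneg (by positivity) (ha j))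

theorem geom_mean_le_weighted (a : ℕ → ℝ) (ha : ∀ k, 0 ≤ a k) (k : ℕ) :
    (∏ j ∈ Finset.range (k + 1), a j) ^ (1 / ((k : ℝ) + 1)) ≤
      Real.exp 1 *
        ((∑ j ∈ Finset.range (k + 1), ((j : ℝ) + 1) * a j) / ((k : ℝ) + 1) ^ 2) := by
  have hk : (0 : ℝ) < (k : ℝ) + 1 := by positivity
  have hamgm := Real.geom_mean_le_arith_mean_weighted (Finset.range (k + 1))
    (fun _ => 1 / ((k : ℝ) + 1)) (fun j => ((j : ℝ) + 1) * a j) (fun _ _ => by positivity)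
    (by simp; field_simp) (fun j _ => mul_nonneg (by positivity) (ha j))
  rw [Real.finsetProd_rpow _ _ (fun j _ => mul_nonneg (by positivity) (ha j)),
    Finset.prod_mul_distrib, ← Finset.mul_sum] at hamgm
  have hfact : ∏ j ∈ Finset.range (k + 1), ((j : ℝ) + 1) = ((k + 1).factorial : ℝ) := by
    rw [← Finset.prod_range_add_one_eq_factorial]; push_cast; rfl
  have hP : 0 ≤ ∏ j ∈ Finset.range (k + 1), a j := Finset.prod_nonneg fun j _ => ha j
  rw [hfact, Real.mul_rpow (by positivity) hP] at hamgm
  have hexp := Real.pow_div_factorial_le_exp _ hk.le (k + 1)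
  rw [div_le_iff₀ (by positivity)] at hexp
  have hroot : ((k : ℝ) + 1) ≤ Real.exp 1 * ((k + 1).factorial : ℝ) ^ (1 / ((k : ℝ) + 1)) := by
    have h := Real.rpow_le_rpow (by positivity) hexp (show 0 ≤ 1 / ((k : ℝ) + 1) by positivity)
    rw [Real.mul_rpow (by positivity) (by positivity), ← Real.exp_mul,
      ← Real.rpow_natCast, ← Real.rpow_mul hk.le] at h
    have e : ((k + 1 : ℕ) : ℝ) * (1 / ((k : ℝ) + 1)) = 1 := by push_cast; field_simp
    rwa [e, mul_one_div_cancel hk.ne', Real.rpow_one] at h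
  have hG : 0 ≤ (∏ j ∈ Finset.range (k + 1), a j) ^ (1 / ((k : ℝ) + 1)) := by positivity
  set G := (∏ j ∈ Finset.range (k + 1), a j) ^ (1 / ((k : ℝ) + 1))
  set S := ∑ j ∈ Finset.range (k + 1), ((j : ℝ) + 1) * a j
  have h1 : ((k : ℝ) + 1) * G ≤ Real.exp 1 * (1 / ((k : ℝ) + 1) * S) :=
    calc _ ≤ _ := mul_le_mul_of_nonneg_right hroot hG
      _ = Real.exp 1 * (((k + 1).factorial : ℝ) ^ (1 / ((k : ℝ) + 1)) * G) := by ring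
      _ ≤ _ := by gcongr
  calc G = (((k : ℝ) + 1) * G) / ((k : ℝ) + 1) := by field_simp
    _ ≤ (Real.exp 1 * (1 / ((k : ℝ) + 1) * S)) / ((k : ℝ) + 1) := by gcongr
    _ = _ := by field_simp

/-- **Carleman's inequality**, in qualitative form. -/
theorem Summable.geom_mean {a : ℕ → ℝ} (ha : ∀ k, 0 ≤ a k) (hs : Summable a) :
    Summable fun k : ℕ => (∏ j ∈ Finset.range (k + 1), a j) ^ (1 / ((k : ℝ) + 1)) := by
  refine summable_of_sum_range_le (c := Real.exp 1 * (2 * ∑' k, a k))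
    (fun k => Real.rpow_nonneg (Finset.prod_nonneg fun j _ => ha j) _) fun K => ?_
  calc _ ≤ _ := Finset.sum_le_sum fun k _ => geom_mean_le_weighted a ha k
    _ ≤ _ := by
      rw [← Finset.mul_sum]
      gcongr
      exact (sum_weighted_le a ha K).trans
        (by gcongr; exact hs.sum_le_tsum _ fun k _ => ha k)

theorem not_summable_ratio_of_not_summable_root {M : ℕ → ℝ} (hM : ∀ k, 0 < M k)
    (h : ¬ Summable fun k : ℕ => M (k + 1) ^ (-(1 / ((k : ℝ) + 1)))) :
    ¬ Summable fun k => M k / M (k + 1) := by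
  intro hs
  refine h (Summable.of_nonneg_of_le (fun k => (Real.rpow_pos_of_pos (hM _) _).le) (fun k => ?_)
    ((hs.geom_mean fun k => (div_pos (hM k) (hM _)).le).mul_left (max 1 (M 0)⁻¹)))
  have hprod : ∏ j ∈ Finset.range (k + 1), M j / M (j + 1) = M 0 / M (k + 1) := by
    induction k + 1 with
    | zero => simp [(hM 0).ne']
    | succ m ih =>
      have := (hM m).ne'
      rw [Finset.prod_range_succ, ih]
      field_simp
  have hk : (0 : ℝ) < (k : ℝ) + 1 := by positivity
  rw [hprod, Real.rpow_neg (hM _).le, Real.div_rpow (hM 0).le (hM _).le, ← mul_div_assoc,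
    inv_eq_one_div]
  have := hM (k + 1)
  gcongr
  set p := 1 / ((k : ℝ) + 1)
  have hp : 0 ≤ p := by positivity
  have hp1 : p ≤ 1 := by
    rw [div_le_one hk]; linarith [(k.cast_nonneg : (0 : ℝ) ≤ k)]
  have hM0 := hM 0
  rcases le_total 1 (M 0) with h1 | h1
  · have : 1 ≤ M 0 ^ p := Real.one_le_rpow h1 hp
    calc (1 : ℝ) ≤ 1 * M 0 ^ p := by linarith
      _ ≤ _ := by gcongr; exact le_max_left _ _
  · have : M 0 ≤ M 0 ^ p := by
      simpa using Real.rpow_le_rpow_of_exponent_ge hM0 h1 hp1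
    calc (1 : ℝ) = (M 0)⁻¹ * M 0 := by field_simp
      _ ≤ (M 0)⁻¹ * M 0 ^ p := by gcongr
      _ ≤ _ := by gcongr; exact le_max_right _ _

theorem mul_le_mul_of_logConvex {M : ℕ → ℝ} (hM : ∀ k, 0 < M k)
    (hlog : ∀ k, M (k + 1) ^ 2 ≤ M k * M (k + 2)) {k N : ℕ} (hk : k ≤ N) :
    M (k + 1) * M N ≤ M k * M (N + 1) := by
  have hmono : Monotone fun k => M (k + 1) / M k := monotone_nat_of_le_succ fun k => by
    rw [div_le_div_iff₀ (hM _) (hM _)]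
    linarith [hlog k]
  have := hmono hk
  rw [div_le_div_iff₀ (hM _) (hM _)] at this
  linarith

section DenjoyCarleman

variable {E : Type*} [NormedAddCommGroup E] [NormedSpace ℝ E]

theorem norm_le_mul_exp_of_logConvex {F : ℕ → ℝ → E}
    (hF : ∀ k t, HasDerivAt (F k) (F (k + 1) t) t) {M : ℕ → ℝ} (hM : ∀ k, 0 < M k)
    (hlog : ∀ k, M (k + 1) ^ 2 ≤ M k * M (k + 2)) {D : ℝ} (hD : 0 ≤ D) {N : ℕ} {x : ℝ}
    (hx : ∀ k, ‖F k x‖ ≤ D * (Real.exp k * M k))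
    (hN : ∀ y, ‖F (N + 1) y‖ ≤ D * (Real.exp (N + 1 : ℕ) * M (N + 1)))
    {k : ℕ} (hk : k ≤ N + 1) {y : ℝ} (hy : x ≤ y) :
    ‖F k y‖ ≤ D * (Real.exp k * M k) * Real.exp (Real.exp 1 * (M (N + 1) / M N) * (y - x)) := by
  set r := Real.exp 1 * (M (N + 1) / M N) with hr
  have hr0 : 0 ≤ r := mul_nonneg (Real.exp_pos _).le (div_pos (hM _) (hM _)).le
  induction hk using Nat.decreasingInduction generalizing y with
  | self =>
    refine (hN y).trans (le_mul_of_one_le_right ?_ (Real.one_le_exp ?_))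
    · have := hM (N + 1); positivity
    · exact mul_nonneg hr0 (sub_nonneg.2 hy)
  | of_succ k hk ih =>
    refine image_norm_le_of_norm_deriv_right_le_deriv_boundary (f := F k) (f' := F (k + 1))
      (a := x) (b := y)
      (B := fun y => D * (Real.exp k * M k) * Real.exp (r * (y - x)))
      (B' := fun y => D * (Real.exp k * M k) * (Real.exp (r * (y - x)) * (r * 1)))
      (fun z _ => (hF k z).continuousAt.continuousWithinAt)
      (fun z _ => (hF k z).hasDerivWithinAt) (by simpa using hx k)
      (fun z => ((((hasDerivAt_id z).sub_const x).const_mul r).exp).const_mul _)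
      (fun z hz => (ih hz.1).trans ?_) (Set.right_mem_Icc.2 hy)
    have hstep : Real.exp (k + 1 : ℕ) * M (k + 1) ≤ Real.exp k * M k * r := by
      have h := mul_le_mul_of_logConvex hM hlog (Nat.lt_succ_iff.1 hk)
      have h' : M (k + 1) ≤ M k * (M (N + 1) / M N) := by
        rw [← mul_div_assoc, le_div_iff₀ (hM N)]; exact h
      push_cast
      rw [Real.exp_add]
      calc _ ≤ Real.exp k * Real.exp 1 * (M k * (M (N + 1) / M N)) := by gcongr
        _ = _ := by rw [hr]; ring
    calc _ ≤ D * (Real.exp k * M k * r) * Real.exp (r * (z - x)) := by gcongr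
      _ = _ := by ring

theorem norm_le_exp_neg_of_flat {F : ℕ → ℝ → E}
    (hF : ∀ k t, HasDerivAt (F k) (F (k + 1) t) t) {M : ℕ → ℝ} (hM : ∀ k, 0 < M k)
    (hlog : ∀ k, M (k + 1) ^ 2 ≤ M k * M (k + 2)) {C : ℝ} (hC : 0 ≤ C)
    (hb : ∀ k t, ‖F k t‖ ≤ C * M k) (h0 : ∀ k, F k 0 = 0) (d N : ℕ) {y : ℝ} (hy0 : 0 ≤ y)
    (hy : y ≤ ∑ j ∈ Finset.range d, (Real.exp 1)⁻¹ * (M (N + j) / M (N + j + 1))) (k : ℕ) :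
    ‖F k y‖ ≤ C * Real.exp (-N) * (Real.exp k * M k) := by
  induction d generalizing N y k with
  | zero =>
    obtain rfl : y = 0 := le_antisymm (by simpa using hy) hy0
    rw [h0, norm_zero]
    have := hM k; positivity
  | succ d ih =>
    have hMk := hM k
    have hlarge : ∀ (n m : ℕ), n ≤ m → ∀ z,
        ‖F m z‖ ≤ C * Real.exp (-n) * (Real.exp m * M m) := fun n m hnm z => by
      have h1 : 1 ≤ Real.exp (-n) * Real.exp m := by
        rw [← Real.exp_add]
        refine Real.one_le_exp ?_
        have : (n : ℝ) ≤ m := by exact_mod_cast hnm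
        linarith
      calc _ ≤ C * M m := hb m z
        _ ≤ (C * M m) * (Real.exp (-n) * Real.exp m) :=
          le_mul_of_one_le_right (mul_nonneg hC (hM m).le) h1
        _ = _ := by ring
    rcases le_total N k with hNk | hkN
    · exact hlarge N k hNk y
    rw [Finset.sum_range_succ'] at hy
    have hsum : ∑ j ∈ Finset.range d, (Real.exp 1)⁻¹ * (M (N + (j + 1)) / M (N + (j + 1) + 1))
        = ∑ j ∈ Finset.range d, (Real.exp 1)⁻¹ * (M (N + 1 + j) / M (N + 1 + j + 1)) := by
      refine Finset.sum_congr rfl fun j _ => ?_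
      rw [show N + (j + 1) = N + 1 + j by ring]
    rw [hsum] at hy
    set x := ∑ j ∈ Finset.range d, (Real.exp 1)⁻¹ * (M (N + 1 + j) / M (N + 1 + j + 1))
    have hx0 : 0 ≤ x := Finset.sum_nonneg fun j _ =>
      mul_nonneg (by positivity) (div_pos (hM _) (hM _)).le
    rcases le_total y x with hyx | hxy
    · refine (ih (N + 1) hy0 hyx k).trans ?_
      gcongr
      simp
    · have hstep := norm_le_mul_exp_of_logConvex hF hM hlog
        (D := C * Real.exp (-(N + 1 : ℕ))) (by positivity) (N := N) (x := x)
        (fun k => ih (N + 1) hx0 le_rfl k)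
        (fun z => hlarge (N + 1) (N + 1) le_rfl z) (k := k) (by omega) hxy
      have hexp : Real.exp (Real.exp 1 * (M (N + 1) / M N) * (y - x)) ≤ Real.exp 1 := by
        refine Real.exp_le_exp.2 ?_
        have h1 : y - x ≤ (Real.exp 1)⁻¹ * (M N / M (N + 1)) := by simpa using sub_left_le_of_le_add hy
        have := hM N
        have := hM (N + 1)
        calc _ ≤ Real.exp 1 * (M (N + 1) / M N) * ((Real.exp 1)⁻¹ * (M N / M (N + 1))) := by gcongr
          _ = 1 := by field_simp
      calc _ ≤ _ := hstep
        _ ≤ C * Real.exp (-(N + 1 : ℕ)) * (Real.exp k * M k) * Real.exp 1 := by gcongr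
        _ = C * (Real.exp (-(N + 1 : ℕ)) * Real.exp 1) * (Real.exp k * M k) := by ring
        _ = _ := by
          rw [← Real.exp_add]; push_cast; ring_nf

theorem eq_zero_of_flat_of_nonneg {F : ℕ → ℝ → E}
    (hF : ∀ k t, HasDerivAt (F k) (F (k + 1) t) t) {M : ℕ → ℝ} (hM : ∀ k, 0 < M k)
    (hlog : ∀ k, M (k + 1) ^ 2 ≤ M k * M (k + 2))
    (hdiv : ¬ Summable fun k => M k / M (k + 1)) {C : ℝ} (hC : 0 ≤ C)
    (hb : ∀ k t, ‖F k t‖ ≤ C * M k) (h0 : ∀ k, F k 0 = 0) {y : ℝ} (hy : 0 ≤ y) :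
    F 0 y = 0 := by
  have hbound : ∀ N : ℕ, ‖F 0 y‖ ≤ C * M 0 * Real.exp (-N) := fun N => by
    have hdiv' : ¬ Summable fun j => (Real.exp 1)⁻¹ * (M (N + j) / M (N + j + 1)) := by
      rw [summable_mul_left_iff (by positivity)]
      have h := mt (summable_nat_add_iff (f := fun k => M k / M (k + 1)) N).1 hdiv
      simpa only [add_comm _ N] using h
    rw [not_summable_iff_tendsto_nat_atTop_of_nonneg fun j =>
      mul_nonneg (by positivity) (div_pos (hM _) (hM _)).le] at hdiv'
    obtain ⟨d, hd⟩ := (hdiv'.eventually_ge_atTop y).exists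
    have h := norm_le_exp_neg_of_flat hF hM hlog hC hb h0 d N hy hd 0
    simp only [Nat.cast_zero, Real.exp_zero, one_mul] at h
    linarith
  have hlim : Filter.Tendsto (fun N : ℕ => C * M 0 * Real.exp (-N)) Filter.atTop (nhds 0) := by
    have := (Real.tendsto_exp_neg_atTop_nhds_zero.comp tendsto_natCast_atTop_atTop).const_mul
      (C * M 0)
    simpa using this
  exact norm_le_zero_iff.1 (ge_of_tendsto' hlim hbound)

/-- **Denjoy–Carleman theorem**: a smooth function on the line, flat at `0`, vanishes identically
when its derivatives are bounded by a log-convex sequence with divergent sum of ratios. -/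
theorem eq_zero_of_flat {F : ℕ → ℝ → E}
    (hF : ∀ k t, HasDerivAt (F k) (F (k + 1) t) t) {M : ℕ → ℝ} (hM : ∀ k, 0 < M k)
    (hlog : ∀ k, M (k + 1) ^ 2 ≤ M k * M (k + 2))
    (hdiv : ¬ Summable fun k => M k / M (k + 1)) {C : ℝ} (hC : 0 ≤ C)
    (hb : ∀ k t, ‖F k t‖ ≤ C * M k) (h0 : ∀ k, F k 0 = 0) (y : ℝ) : F 0 y = 0 := by
  rcases le_total 0 y with hy | hy
  · exact eq_zero_of_flat_of_nonneg hF hM hlog hdiv hC hb h0 hy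
  · have := eq_zero_of_flat_of_nonneg (F := fun k t => (-1 : ℝ) ^ k • F k (-t))
      (fun k t => by
        have h := ((hF k (-t)).scomp t (hasDerivAt_neg t)).const_smul ((-1 : ℝ) ^ k)
        rwa [smul_smul, ← pow_succ] at h)
      hM hlog hdiv hC (fun k t => by simpa [norm_smul] using hb k (-t))
      (fun k => by simp [h0]) (neg_nonneg.2 hy)
    simpa using this

end DenjoyCarleman

theorem integral_abs_mul_abs_le_sqrt {Ω : Type*} [MeasurableSpace Ω] {μ : Measure Ω}
    {f g : Ω → ℝ} (hf : MemLp f 2 μ) (hg : MemLp g 2 μ) :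
    ∫ x, |f x| * |g x| ∂μ ≤ √(∫ x, f x ^ 2 ∂μ) * √(∫ x, g x ^ 2 ∂μ) := by
  have h := integral_mul_le_Lp_mul_Lq_of_nonneg (μ := μ) Real.HolderConjugate.two_two
    (f := fun x => |f x|) (g := fun x => |g x|) (ae_of_all _ fun x => abs_nonneg _)
    (ae_of_all _ fun x => abs_nonneg _) (by simpa using hf.norm) (by simpa using hg.norm)
  simpa [Real.sqrt_eq_rpow] using h

theorem sq_sqrt_moment_le {Ω : Type*} [MeasurableSpace Ω] {μ : Measure Ω} {y : Ω → ℝ}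
    (hy : ∀ k : ℕ, MemLp (fun x => y x ^ k) 2 μ) (k : ℕ) :
    √(∫ x, y x ^ (2 * (k + 1)) ∂μ) ^ 2 ≤
      √(∫ x, y x ^ (2 * k) ∂μ) * √(∫ x, y x ^ (2 * (k + 2)) ∂μ) := by
  rw [Real.sq_sqrt (integral_nonneg fun x => (even_two_mul _).pow_nonneg _)]
  have h := integral_abs_mul_abs_le_sqrt (hy k) (hy (k + 2))
  simp only [← pow_mul, mul_comm _ 2] at h
  refine le_trans (le_of_eq (integral_congr_ae (ae_of_all _ fun x => ?_))) h
  dsimp only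
  rw [← abs_mul, ← pow_add, show k + (k + 2) = 2 * (k + 1) by ring,
    abs_of_nonneg ((even_two_mul _).pow_nonneg _)]

theorem moment_pos_of_carleman {Ω : Type*} [MeasurableSpace Ω] {μ : Measure Ω} {y : Ω → ℝ}
    (hy : ∀ k : ℕ, MemLp (fun x => y x ^ k) 2 μ)
    (hc : ¬ Summable fun k : ℕ =>
      (∫ x, y x ^ (2 * (k + 1)) ∂μ) ^ (-(1 / (2 * ((k : ℝ) + 1))))) (k : ℕ) :
    0 < ∫ x, y x ^ (2 * k) ∂μ := by
  have hnn : ∀ k x, 0 ≤ y x ^ (2 * k) := fun k x => (even_two_mul _).pow_nonneg _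
  refine (integral_nonneg (hnn k)).lt_of_ne fun h0 => hc ?_
  have hint : Integrable (fun x => y x ^ (2 * k)) μ := by
    have := (hy k).integrable_sq
    simpa only [← pow_mul, mul_comm _ 2] using this
  have hae := (integral_eq_zero_iff_of_nonneg (hnn k) hint).1 h0.symm
  have hzero : ∀ m : ℕ, ∫ x, y x ^ (2 * (m + 1)) ∂μ = 0 := fun m => by
    refine integral_eq_zero_of_ae (hae.mono fun x hx => ?_)
    have : y x = 0 := eq_zero_of_pow_eq_zero hx
    simp [this]
  refine summable_zero.congr fun m => ?_
  rw [hzero, Real.zero_rpow]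
  have : (0 : ℝ) < 1 / (2 * ((m : ℝ) + 1)) := by positivity
  linarith

theorem integrable_mul_I_pow {Ω : Type*} [MeasurableSpace Ω] {μ : Measure Ω} {y : Ω → ℝ}
    {g : Ω → ℂ} (hy : ∀ k : ℕ, MemLp (fun x => y x ^ k) 2 μ) (hg : MemLp g 2 μ) (k : ℕ) :
    Integrable (fun x => g x * (Complex.I * y x) ^ k) μ := by
  have h := (hg.integrable_mul (hy k).ofReal (𝕜 := ℂ)).const_mul (Complex.I ^ k)
  refine h.congr (ae_of_all _ fun x => ?_)
  simp
  ring

theorem integrable_mul_I_pow_mul_exp {Ω : Type*} [MeasurableSpace Ω] {μ : Measure Ω} {y : Ω → ℝ}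
    {g : Ω → ℂ} (hym : Measurable y) (hy : ∀ k : ℕ, MemLp (fun x => y x ^ k) 2 μ)
    (hg : MemLp g 2 μ) (k : ℕ) (t : ℝ) :
    Integrable (fun x => g x * (Complex.I * y x) ^ k * Complex.exp ((t * y x : ℝ) * Complex.I))
      μ := by
  refine (integrable_mul_I_pow hy hg k).mul_bdd (c := 1) (by fun_prop) (ae_of_all _ fun x => ?_)
  rw [Complex.norm_exp_ofReal_mul_I]

theorem hasDerivAt_integral_mul_I_pow_mul_exp {Ω : Type*} [MeasurableSpace Ω] {μ : Measure Ω}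
    {y : Ω → ℝ} {g : Ω → ℂ} (hym : Measurable y)
    (hy : ∀ k : ℕ, MemLp (fun x => y x ^ k) 2 μ) (hg : MemLp g 2 μ) (k : ℕ) (t : ℝ) :
    HasDerivAt
      (fun t : ℝ => ∫ x, g x * (Complex.I * y x) ^ k *
        Complex.exp ((t * y x : ℝ) * Complex.I) ∂μ)
      (∫ x, g x * (Complex.I * y x) ^ (k + 1) * Complex.exp ((t * y x : ℝ) * Complex.I) ∂μ)
      t := by
  refine (hasDerivAt_integral_of_dominated_loc_of_deriv_le (s := Set.univ) Filter.univ_mem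
    (F := fun (t : ℝ) x => g x * (Complex.I * y x) ^ k *
      Complex.exp ((t * y x : ℝ) * Complex.I))
    (F' := fun (t : ℝ) x => g x * (Complex.I * y x) ^ (k + 1) *
      Complex.exp ((t * y x : ℝ) * Complex.I))
    (bound := fun x => ‖g x * (Complex.I * y x) ^ (k + 1)‖)
    (Filter.Eventually.of_forall fun s =>
      (integrable_mul_I_pow_mul_exp hym hy hg k s).aestronglyMeasurable)
    (integrable_mul_I_pow_mul_exp hym hy hg k t)
    (integrable_mul_I_pow_mul_exp hym hy hg (k + 1) t).aestronglyMeasurable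
    (ae_of_all _ fun x s _ => ?_) (integrable_mul_I_pow hy hg (k + 1)).norm
    (ae_of_all _ fun x s _ => ?_)).2
  · rw [norm_mul _ (Complex.exp _), Complex.norm_exp_ofReal_mul_I, mul_one]
  · have h1 : HasDerivAt (fun s : ℝ => ((s * y x : ℝ) : ℂ) * Complex.I) (y x * Complex.I) s := by
      simpa using (((hasDerivAt_id s).mul_const (y x)).ofReal_comp).mul_const Complex.I
    exact (h1.cexp.const_mul (g x * (Complex.I * y x) ^ k)).congr_deriv (by ring)

theorem norm_integral_mul_I_pow_mul_exp_le {Ω : Type*} [MeasurableSpace Ω] {μ : Measure Ω}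
    {y : Ω → ℝ} {g : Ω → ℂ} (hy : ∀ k : ℕ, MemLp (fun x => y x ^ k) 2 μ)
    (hg : MemLp g 2 μ) (k : ℕ) (t : ℝ) :
    ‖∫ x, g x * (Complex.I * y x) ^ k * Complex.exp ((t * y x : ℝ) * Complex.I) ∂μ‖ ≤
      √(∫ x, ‖g x‖ ^ 2 ∂μ) * √(∫ x, y x ^ (2 * k) ∂μ) := by
  refine (norm_integral_le_integral_norm _).trans ?_
  have h := integral_abs_mul_abs_le_sqrt hg.norm (hy k)
  simp only [← pow_mul, mul_comm _ 2] at h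
  refine le_trans (le_of_eq (integral_congr_ae (ae_of_all _ fun x => ?_))) h
  dsimp only
  rw [norm_mul _ (Complex.exp _), Complex.norm_exp_ofReal_mul_I]
  simp [abs_pow]

/-- If `y` satisfies Carleman's condition, weighted Fourier transforms along `y` are determined by
their derivatives at `0`. -/
theorem integral_mul_exp_eq_of_carleman {Ω : Type*} [MeasurableSpace Ω] {μ ν : Measure Ω}
    {y : Ω → ℝ} {g : Ω → ℂ} (hym : Measurable y)
    (hyμ : ∀ k : ℕ, MemLp (fun x => y x ^ k) 2 μ) (hyν : ∀ k : ℕ, MemLp (fun x => y x ^ k) 2 ν)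
    (hgμ : MemLp g 2 μ) (hgν : MemLp g 2 ν)
    (hmom : ∀ k : ℕ, ∫ x, y x ^ (2 * k) ∂μ = ∫ x, y x ^ (2 * k) ∂ν)
    (hc : ¬ Summable fun k : ℕ =>
      (∫ x, y x ^ (2 * (k + 1)) ∂μ) ^ (-(1 / (2 * ((k : ℝ) + 1)))))
    (hflat : ∀ k : ℕ, ∫ x, g x * (y x : ℂ) ^ k ∂μ = ∫ x, g x * (y x : ℂ) ^ k ∂ν) (t : ℝ) :
    ∫ x, g x * Complex.exp ((t * y x : ℝ) * Complex.I) ∂μ =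
      ∫ x, g x * Complex.exp ((t * y x : ℝ) * Complex.I) ∂ν := by
  have hpos := moment_pos_of_carleman hyμ hc
  have hzero := eq_zero_of_flat
    (F := fun k t =>
      (∫ x, g x * (Complex.I * y x) ^ k * Complex.exp ((t * y x : ℝ) * Complex.I) ∂μ) -
      ∫ x, g x * (Complex.I * y x) ^ k * Complex.exp ((t * y x : ℝ) * Complex.I) ∂ν)
    (fun k t => (hasDerivAt_integral_mul_I_pow_mul_exp hym hyμ hgμ k t).sub
      (hasDerivAt_integral_mul_I_pow_mul_exp hym hyν hgν k t))
    (M := fun k => √(∫ x, y x ^ (2 * k) ∂μ)) (fun k => Real.sqrt_pos.2 (hpos k))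
    (sq_sqrt_moment_le hyμ)
    (not_summable_ratio_of_not_summable_root (fun k => Real.sqrt_pos.2 (hpos k)) ?_)
    (C := √(∫ x, ‖g x‖ ^ 2 ∂μ) + √(∫ x, ‖g x‖ ^ 2 ∂ν)) (by positivity)
    (fun k t => ?_) (fun k => ?_) t
  · simpa [sub_eq_zero] using hzero
  · refine fun h => hc (h.congr fun k => ?_)
    rw [Real.sqrt_eq_rpow, ← Real.rpow_mul (hpos _).le]
    congr 1
    field_simp
  · refine (norm_sub_le _ _).trans ?_
    rw [add_mul]
    refine add_le_add (norm_integral_mul_I_pow_mul_exp_le hyμ hgμ k t) ?_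
    rw [hmom k]
    exact norm_integral_mul_I_pow_mul_exp_le hyν hgν k t
  · have e : ∀ x, g x * (Complex.I * y x) ^ k * Complex.exp (((0 : ℝ) * y x : ℝ) * Complex.I) =
        Complex.I ^ k * (g x * (y x : ℂ) ^ k) := fun x => by
      simp [mul_pow]; ring
    simp only [e, integral_const_mul, hflat, sub_self]

section Multivariate

variable {n : ℕ}

theorem memLp_two_monomial {μ : Measure (Fin n → ℝ)}
    (hμ : ∀ α : Fin n →₀ ℕ, Integrable (fun x => ∏ i, x i ^ α i) μ) (α : Fin n →₀ ℕ) :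
    MemLp (fun x : Fin n → ℝ => ∏ i, x i ^ α i) 2 μ := by
  rw [memLp_two_iff_integrable_sq (hμ α).aestronglyMeasurable]
  refine (hμ (2 • α)).congr (ae_of_all _ fun x => ?_)
  simp [← Finset.prod_pow, ← pow_mul, mul_comm]

theorem prod_pow_single {R : Type*} [CommMonoid R] (x : Fin n → R) (j : Fin n) (k : ℕ) :
    ∏ i, x i ^ (Finsupp.single j k) i = x j ^ k := by
  rw [Finset.prod_eq_single j] <;> simp +contextual [eq_comm]

theorem memLp_two_monomial_mul_exp {μ : Measure (Fin n → ℝ)}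
    (hμ : ∀ α : Fin n →₀ ℕ, Integrable (fun x => ∏ i, x i ^ α i) μ) (α : Fin n →₀ ℕ)
    (s : Finset (Fin n)) (t : Fin n → ℝ) :
    MemLp (fun x : Fin n → ℝ => (∏ i, (x i : ℂ) ^ α i) *
      Complex.exp ((∑ i ∈ s, t i * x i : ℝ) * Complex.I)) 2 μ := by
  refine (memLp_two_monomial hμ α).congr_norm (by fun_prop) (ae_of_all _ fun x => ?_)
  rw [norm_mul, Complex.norm_exp_ofReal_mul_I]
  simp

theorem integral_monomial_mul_exp_eq {μ ν : Measure (Fin n → ℝ)}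
    (hμ : ∀ α : Fin n →₀ ℕ, Integrable (fun x => ∏ i, x i ^ α i) μ)
    (hν : ∀ α : Fin n →₀ ℕ, Integrable (fun x => ∏ i, x i ^ α i) ν)
    (hc : Carleman μ)
    (h : ∀ α : Fin n →₀ ℕ, ∫ x, ∏ i, x i ^ α i ∂μ = ∫ x, ∏ i, x i ^ α i ∂ν)
    (s : Finset (Fin n)) (α : Fin n →₀ ℕ) (t : Fin n → ℝ) :
    ∫ x, (∏ i, (x i : ℂ) ^ α i) * Complex.exp ((∑ i ∈ s, t i * x i : ℝ) * Complex.I) ∂μ =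
      ∫ x, (∏ i, (x i : ℂ) ^ α i) * Complex.exp ((∑ i ∈ s, t i * x i : ℝ) * Complex.I) ∂ν := by
  induction s using Finset.induction_on generalizing α with
  | empty =>
    have e : ∀ x : Fin n → ℝ, (∏ i, (x i : ℂ) ^ α i) *
        Complex.exp ((∑ i ∈ (∅ : Finset (Fin n)), t i * x i : ℝ) * Complex.I) =
        ((∏ i, x i ^ α i : ℝ) : ℂ) := fun x => by simp
    simp only [e]
    rw [integral_complex_ofReal, integral_complex_ofReal, h]
  | insert j s hj ih =>
    have hpow : ∀ {ρ : Measure (Fin n → ℝ)},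
        (∀ α : Fin n →₀ ℕ, Integrable (fun x => ∏ i, x i ^ α i) ρ) →
        ∀ k : ℕ, MemLp (fun x : Fin n → ℝ => x j ^ k) 2 ρ := fun hρ k => by
      simpa only [prod_pow_single] using memLp_two_monomial hρ (Finsupp.single j k)
    have hstep := integral_mul_exp_eq_of_carleman (measurable_pi_apply j) (hpow hμ) (hpow hν)
      (memLp_two_monomial_mul_exp hμ α s t) (memLp_two_monomial_mul_exp hν α s t)
      (fun k => by simpa only [prod_pow_single] using h (Finsupp.single j (2 * k)))
      (hc j) (fun k => ?_) (t j)
    · have e : ∀ x : Fin n → ℝ, (∏ i, (x i : ℂ) ^ α i) *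
          Complex.exp ((∑ i ∈ insert j s, t i * x i : ℝ) * Complex.I) =
          (∏ i, (x i : ℂ) ^ α i) * Complex.exp ((∑ i ∈ s, t i * x i : ℝ) * Complex.I) *
            Complex.exp ((t j * x j : ℝ) * Complex.I) := fun x => by
        rw [Finset.sum_insert hj, mul_assoc, ← Complex.exp_add, Complex.ofReal_add]
        congr 2
        ring
      simpa only [e] using hstep
    · have e : ∀ x : Fin n → ℝ,
          (∏ i, (x i : ℂ) ^ α i) * Complex.exp ((∑ i ∈ s, t i * x i : ℝ) * Complex.I) *
            (x j : ℂ) ^ k =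
          (∏ i, (x i : ℂ) ^ (α + Finsupp.single j k) i) *
            Complex.exp ((∑ i ∈ s, t i * x i : ℝ) * Complex.I) := fun x => by
        have := prod_pow_single (fun i => (x i : ℂ)) j k
        simp only [Finsupp.add_apply, pow_add, Finset.prod_mul_distrib, this]
        ring
      simpa only [e] using ih (α + Finsupp.single j k)

/-- A finite measure satisfying the multivariate Carleman condition is determined by its
moments. -/
theorem Carleman.measure_ext {μ ν : Measure (Fin n → ℝ)} [IsFiniteMeasure μ] [IsFiniteMeasure ν]
    (hc : Carleman μ)
    (hμ : ∀ α : Fin n →₀ ℕ, Integrable (fun x => ∏ i, x i ^ α i) μ)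
    (hν : ∀ α : Fin n →₀ ℕ, Integrable (fun x => ∏ i, x i ^ α i) ν)
    (h : ∀ α : Fin n →₀ ℕ, ∫ x, ∏ i, x i ^ α i ∂μ = ∫ x, ∏ i, x i ^ α i ∂ν) : μ = ν := by
  refine Measure.ext_of_charFunDual (funext fun L => ?_)
  have hL : ∀ x : Fin n → ℝ, L x = ∑ i, L (Pi.single i 1) * x i := fun x => by
    conv_lhs => rw [← Finset.univ_sum_single x, map_sum]
    refine Finset.sum_congr rfl fun i _ => ?_
    rw [show Pi.single i (x i) = x i • (Pi.single i 1 : Fin n → ℝ) by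
      rw [← Pi.single_smul, smul_eq_mul, mul_one], map_smul, smul_eq_mul, mul_comm]
  have hexp := integral_monomial_mul_exp_eq hμ hν hc h Finset.univ 0 fun i => L (Pi.single i 1)
  simp only [← hL] at hexp
  simpa [charFunDual_apply] using hexp

end Multivariate

theorem stmt14 {n : ℕ} (μp μm ψ : Measure (Fin n → ℝ))
    [IsFiniteMeasure μp] [IsFiniteMeasure μm] [IsFiniteMeasure ψ]
    (hmomp : ∀ α : Fin n →₀ ℕ, Integrable (fun x => ∏ i, x i ^ α i) μp)
    (hmomm : ∀ α : Fin n →₀ ℕ, Integrable (fun x => ∏ i, x i ^ α i) μm)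
    (hmomψ : ∀ α : Fin n →₀ ℕ, Integrable (fun x => ∏ i, x i ^ α i) ψ)
    (hcp : Carleman μp) (hcm : Carleman μm)
    (heq : ∀ α : Fin n →₀ ℕ,
      ∫ x, ∏ i, x i ^ α i ∂μp =
        (∫ x, ∏ i, x i ^ α i ∂μm) + ∫ x, ∏ i, x i ^ α i ∂ψ) :
    μp = μm + ψ := by
  have hint (α : Fin n →₀ ℕ) : Integrable (fun x => ∏ i, x i ^ α i) (μm + ψ) :=
    (hmomm α).add_measure (hmomψ α)
  refine hcp.measure_ext hmomp hint fun α => ?_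
  rw [heq α, integral_add_measure (hmomm α) (hmomψ α)]
end
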